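/- arXiv:2506.17216 — 3 statements merged into one kernel-verified Lean document; each statement's English description precedes it below -/
import Mathlib

section
/- If 𝒟 is a symmetric (15,8,4)-design of type (C2), then Aut(𝒟) is a semidirect product: there exist a normal subgroup N of Aut(𝒟) and a subgroup H of Aut(𝒟) with N ∩ H trivial and N · H = Aut(𝒟), such that H is isomorphic to the symmetric group S₃ on 3 letters, and N itself contains a normal subgroup N₀ isomorphic to (ZMod 2) × (ZMod 2) and a subgroup K isomorphic to the symmetric group S₄ on 4 letters with N₀ ∩ K trivial and N₀ · K = N. -/
/-- A symmetric (15,8,4)-design: 15 blocks, each an 8-element subset of `Fin 15`,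
any two distinct blocks meeting in exactly 4 points. -/
def IsDesign (B : Finset (Finset (Fin 15))) : Prop :=
  B.card = 15 ∧ (∀ b ∈ B, b.card = 8) ∧
    ∀ b ∈ B, ∀ b' ∈ B, b ≠ b' → (b ∩ b').card = 4

private lemma exists_preimage' {β : Type*} [Finite β] {P : β → Prop} {F : β → β}
    (hF : Function.Injective F) (h : ∀ b, P b → P (F b)) {b : β} (hb : P b) :
    ∃ b', P b' ∧ F b' = b := by
  have hGinj : Function.Injective (fun x : {x // P x} => (⟨F x.1, h _ x.2⟩ : {x // P x})) := by
    intro x y hxy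
    exact Subtype.ext (hF (congrArg Subtype.val hxy))
  obtain ⟨x, hx⟩ := (Finite.injective_iff_surjective.mp hGinj) ⟨b, hb⟩
  exact ⟨x.1, x.2, congrArg Subtype.val hx⟩

/-- The full automorphism group of the design with block family `B`. -/
def designAut (B : Finset (Finset (Fin 15))) : Subgroup (Equiv.Perm (Fin 15)) where
  carrier := {σ | ∀ b ∈ B, b.image ⇑σ ∈ B}
  one_mem' := by intro b hb; simpa using hb
  mul_mem' := by
    intro a c ha hc b hb
    have := ha _ (hc b hb)
    simpa [Finset.image_image, Equiv.Perm.coe_mul] using this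
  inv_mem' := by
    intro σ hσ b hb
    obtain ⟨b', hb', hEq⟩ := exists_preimage' (F := fun s => Finset.image (⇑σ) s)
      (Finset.image_injective σ.injective) (fun s hs => hσ s hs) hb
    rw [← hEq, Finset.image_image]
    have : ⇑σ⁻¹ ∘ ⇑σ = id := by
      funext x; simp
    rw [this, Finset.image_id]
    exact hb'

/-- `O` is a center point of the block family `B`. -/
def IsCenter (B : Finset (Finset (Fin 15))) (O : Finset (Fin 15)) : Prop :=
  O ∈ B ∧ ∀ b ∈ B, b ≠ O → symmDiff O b ∈ B

namespace Design

/-- The plane over the field with two elements. -/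
abbrev Plane := ZMod 2 × ZMod 2

/-- The symplectic form on the plane. -/
def symp (a x : Plane) : ZMod 2 := a.1 * x.2 + a.2 * x.1

/-- The indicator function of the nonzero vectors of the plane. -/
def nz (x : Plane) : ZMod 2 := x.1 + x.2 + x.1 * x.2

/-- The functions on the 16-element space that describe the blocks of the model design. -/
def modelFun (u v : Plane) (w : Plane × Plane) : ZMod 2 :=
  symp u w.2 + symp v w.1 + nz u * nz w.1

theorem symp_add_left (a b x : Plane) : symp (a + b) x = symp a x + symp b x := by
  simp only [symp, Prod.fst_add, Prod.snd_add]; ring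

theorem symp_add_right (a x y : Plane) : symp a (x + y) = symp a x + symp a y := by
  simp only [symp, Prod.fst_add, Prod.snd_add]; ring

theorem plane_add_self (x : Plane) : x + x = 0 := CharTwo.add_self_eq_zero x

theorem symp_self (a : Plane) : symp a a = 0 := by
  revert a; decide

theorem symp_zero_right (a : Plane) : symp a 0 = 0 := by simp [symp]

theorem symp_zero_left (a : Plane) : symp 0 a = 0 := by simp [symp]

theorem symp_comm (a b : Plane) : symp a b = symp b a := by
  simp only [symp]; ring

theorem symp_nondegenerate (a b : Plane) (h : ∀ x, symp a x = symp b x) : a = b := by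
  revert a b; decide

theorem nz_eq (x : Plane) : nz x = if x = 0 then 0 else 1 := by
  revert x; decide

/-- Every additive functional on the plane is represented by the symplectic form. -/
theorem exists_symp_eq (l : Plane → ZMod 2) (h : ∀ x y, l (x + y) = l x + l y) :
    ∃ a, ∀ x, l x = symp a x := by
  have h0 : l 0 = 0 := by simpa using h 0 0
  have h1 : l (1, 1) = l (1, 0) + l (0, 1) := by rw [← h]; rfl
  refine ⟨(l (0, 1), l (1, 0)), ?_⟩
  intro x
  have hx : ∀ x : Plane, x = 0 ∨ x = (0, 1) ∨ x = (1, 0) ∨ x = (1, 1) := by decide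
  obtain rfl | rfl | rfl | rfl := hx x
  · rw [h0, symp_zero_right]
  · simp [symp]
  · simp [symp]
  · simp [symp, h1, add_comm]

section PermPlane

variable (τ : Equiv.Perm Plane)

set_option maxRecDepth 100000 in
/-- Every permutation of the plane over the field with two elements is affine. -/
theorem perm_add (a b : Plane) : τ (a + b) = τ a + τ b + τ 0 := by
  revert τ a b; decide

set_option maxRecDepth 100000 in
theorem symp_perm (a b : Plane) : symp (τ a + τ 0) (τ b + τ 0) = symp a b := by
  revert τ a b; decide

theorem nz_perm (a : Plane) : nz (τ a + τ 0) = nz a := by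
  have : τ a + τ 0 = 0 ↔ a = 0 := by
    rw [← CharTwo.sub_eq_add, sub_eq_zero, τ.injective.eq_iff]
  simp only [nz_eq, this]

theorem symp_perm_fixed (b : Plane) : symp (τ 0) (τ b + τ 0) = symp (τ 0) (τ b) := by
  rw [symp_add_right, symp_self, add_zero]

end PermPlane

/-- The permutations of the 16-element space which fix the origin and preserve the family of
functions `modelFun`. -/
def modelAut : Subgroup (Equiv.Perm (Plane × Plane)) where
  carrier := {φ | φ 0 = 0 ∧
    ∀ f : Plane × Plane → ZMod 2,
      (∃ u v, f ∘ φ = modelFun u v) ↔ ∃ u v, f = modelFun u v}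
  one_mem' := ⟨rfl, fun _ => Iff.rfl⟩
  mul_mem' := by
    rintro φ ψ ⟨h0, h⟩ ⟨k0, k⟩
    refine ⟨by simp [h0, k0], fun f => ?_⟩
    rw [← h f, ← k (f ∘ φ)]
    rfl
  inv_mem' := by
    rintro φ ⟨h0, h⟩
    refine ⟨by rw [Equiv.Perm.inv_eq_iff_eq, h0], fun f => ?_⟩
    rw [← h (f ∘ ⇑φ⁻¹)]
    have : (f ∘ ⇑φ⁻¹) ∘ ⇑φ = f := by funext x; simp
    rw [this]

theorem range_le_modelAut {G : Type*} [Group G] (j : G →* Equiv.Perm (Plane × Plane))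
    (h0 : ∀ g, j g 0 = 0)
    (h : ∀ g u v, ∃ u' v', modelFun u v ∘ j g = modelFun u' v') (g : G) :
    j g ∈ modelAut := by
  refine ⟨h0 g, fun f => ⟨?_, ?_⟩⟩
  · rintro ⟨u, v, hf⟩
    obtain ⟨u', v', h'⟩ := h g⁻¹ u v
    refine ⟨u', v', ?_⟩
    rw [← h', ← hf]
    funext x
    simp
  · rintro ⟨u, v, rfl⟩
    exact h g u v

/-- The functions `modelFun 0 v` are those which can be added to all others. -/
theorem central_iff (f : Plane × Plane → ZMod 2) :
    (∃ v, f = modelFun 0 v) ↔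
      (∃ u v, f = modelFun u v) ∧ ∀ u v, ∃ u' v', f + modelFun u v = modelFun u' v' := by
  constructor
  · rintro ⟨v₀, rfl⟩
    refine ⟨⟨0, v₀, rfl⟩, fun u v => ⟨u, v₀ + v, funext fun w => ?_⟩⟩
    simp only [Pi.add_apply, modelFun, symp_add_left, symp_zero_left, nz]
    simp
    ring
  · rintro ⟨⟨u, v, rfl⟩, h⟩
    have key : ∀ u v : Plane, (∀ s, ∃ a b, ∀ w,
        modelFun u v w + modelFun s 0 w = modelFun a b w) → u = 0 := by
      decide
    obtain rfl := key u v fun s => by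
      obtain ⟨a, b, hab⟩ := h s 0
      exact ⟨a, b, congrFun hab⟩
    exact ⟨v, rfl⟩

theorem central_comp {φ : Equiv.Perm (Plane × Plane)} (hφ : φ ∈ modelAut)
    (f : Plane × Plane → ZMod 2) :
    (∃ v, f ∘ φ = modelFun 0 v) ↔ ∃ v, f = modelFun 0 v := by
  obtain ⟨-, h⟩ := hφ
  rw [central_iff, central_iff, h]
  refine and_congr_right fun _ => ⟨fun H u v => ?_, fun H u v => ?_⟩
  · obtain ⟨u', v', h'⟩ := (h (modelFun u v)).2 ⟨u, v, rfl⟩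
    obtain ⟨a, b, hab⟩ := H u' v'
    exact (h _).1 ⟨a, b, by rw [← hab, ← h']; rfl⟩
  · obtain ⟨u', v', h'⟩ := (h (modelFun u v ∘ φ.symm)).1 ⟨u, v, by funext; simp⟩
    obtain ⟨a, b, hab⟩ := H u' v'
    obtain ⟨c, d, hcd⟩ := (h _).2 ⟨a, b, hab⟩
    refine ⟨c, d, ?_⟩
    rw [← hcd, ← h']
    funext; simp

theorem exists_fst_eq {φ : Equiv.Perm (Plane × Plane)} (hφ : φ ∈ modelAut) :
    ∃ a b : Plane, ∀ w, (φ w).1 = (symp a w.1, symp b w.1) := by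
  obtain ⟨a, ha⟩ := (central_comp hφ (modelFun 0 (0, 1))).2 ⟨_, rfl⟩
  obtain ⟨b, hb⟩ := (central_comp hφ (modelFun 0 (1, 0))).2 ⟨_, rfl⟩
  refine ⟨a, b, fun w => Prod.ext ?_ ?_⟩
  · simpa [modelFun, symp, nz] using congrFun ha w
  · simpa [modelFun, symp, nz] using congrFun hb w

theorem nz_fst {φ : Equiv.Perm (Plane × Plane)} (hφ : φ ∈ modelAut) (w : Plane × Plane) :
    nz (φ w).1 = nz w.1 := by
  obtain ⟨a, b, h⟩ := exists_fst_eq hφ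
  have hs : ∀ z : Plane, ∃ x : Plane, (symp a x, symp b x) = z := fun z =>
    ⟨(φ.symm (z, 0)).1, by rw [← h, Equiv.apply_symm_apply]⟩
  rw [h]
  have hinj := Finite.injective_iff_surjective.2 hs
  have : (symp a w.1, symp b w.1) = 0 ↔ w.1 = 0 := by
    refine Iff.trans ?_ (hinj.eq_iff (b := 0))
    simp [symp_zero_right]
  simp only [nz_eq, this]

theorem symp_snd_add {φ : Equiv.Perm (Plane × Plane)} (hφ : φ ∈ modelAut) {u : Plane}
    (hu : u ≠ 0) (w z : Plane × Plane) :
    symp u (φ (w + z)).2 = symp u (φ w).2 + symp u (φ z).2 := by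
  obtain ⟨u', v', h⟩ := (hφ.2 (modelFun u 0)).2 ⟨_, _, rfl⟩
  have hu' : u' ≠ 0 := by
    rintro rfl
    obtain ⟨v, hv⟩ := (central_comp hφ (modelFun u 0)).1 ⟨_, h⟩
    have key : ∀ u v : Plane, (∀ w, modelFun u 0 w = modelFun 0 v w) → u = 0 := by decide
    exact hu (key u v (congrFun hv))
  have h' : ∀ w, symp u (φ w).2 = symp u' w.2 + symp v' w.1 := fun w => by
    have := congrFun h w
    simpa [modelFun, nz_fst hφ, nz_eq u, nz_eq u', hu, hu', symp_zero_left] using this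
  simp only [h', Prod.fst_add, Prod.snd_add, symp_add_right]
  ring

/-- The elements of `modelAut` are additive. -/
theorem map_add_of_mem {φ : Equiv.Perm (Plane × Plane)} (hφ : φ ∈ modelAut)
    (w z : Plane × Plane) : φ (w + z) = φ w + φ z := by
  obtain ⟨a, b, h⟩ := exists_fst_eq hφ
  refine Prod.ext ?_ (Prod.ext ?_ ?_)
  · simp [h, symp_add_right]
  · simpa [symp] using symp_snd_add hφ (u := (0, 1)) (by decide) w z
  · simpa [symp] using symp_snd_add hφ (u := (1, 0)) (by decide) w z

/-- The elements of `modelAut` permute the fibers of the first projection. -/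
theorem fst_eq_of_mem {φ : Equiv.Perm (Plane × Plane)} (hφ : φ ∈ modelAut) (x y z : Plane) :
    (φ (x, y)).1 = (φ (x, z)).1 := by
  obtain ⟨a, b, h⟩ := exists_fst_eq hφ
  rw [h, h]

/-- The copy of `S₃` in the automorphism group of the model. -/
def complementHom : Equiv.Perm {y : Plane // y ≠ 0} →* modelAut :=
  MonoidHom.codRestrict
    { toFun := fun π => Equiv.prodCongr 1 (Equiv.Perm.ofSubtype π)
      map_one' := by rw [map_one]; rfl
      map_mul' := fun π ρ => by rw [map_mul]; rfl } modelAut <|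
  range_le_modelAut _ (fun π => by simp [Prod.ext_iff, Equiv.Perm.ofSubtype_apply_of_not_mem])
    fun π u v => by
      set β : Equiv.Perm Plane := Equiv.Perm.ofSubtype π
      have hβ : β 0 = 0 := Equiv.Perm.ofSubtype_apply_of_not_mem π (by simp)
      refine ⟨β.symm u, v, funext fun w => ?_⟩
      have h1 := symp_perm β (β.symm u) w.2
      have h2 := nz_perm β (β.symm u)
      simp only [hβ, add_zero, Equiv.apply_symm_apply] at h1 h2
      simp [modelFun, β, ← h1, ← h2]

/-- The action of the affine group of the plane on the 16-element space. -/
def affinePerm : Equiv.Perm Plane →* Equiv.Perm (Plane × Plane) :=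
  MonoidHom.toHomPerm
    { toFun := fun τ w => (τ w.1 + τ 0, w.2 + (0, symp (τ 0) (τ w.1)))
      map_one' := funext fun w => by
        change (w.1 + 0, w.2 + ((0 : ZMod 2), symp 0 w.1)) = w
        rw [symp_zero_left, add_zero, Prod.mk_zero_zero, add_zero]
      map_mul' := fun τ ρ => by
        funext w
        have h := symp_perm τ (ρ 0) (ρ w.1)
        have h1 : τ (ρ w.1 + ρ 0) + τ 0 = τ (ρ w.1) + τ (ρ 0) := by
          rw [perm_add, add_assoc, plane_add_self, add_zero]
        have h2 : symp (τ 0) (τ (ρ w.1 + ρ 0)) =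
            symp (τ 0) (τ (ρ w.1)) + symp (τ 0) (τ (ρ 0)) := by
          rw [perm_add, symp_add_right, symp_add_right, symp_self, add_zero]
        have h3 : symp (τ (ρ 0)) (τ (ρ w.1)) = symp (ρ 0) (ρ w.1) +
            symp (τ 0) (τ (ρ w.1 + ρ 0)) := by
          rw [h2, ← h]
          simp only [symp_add_left, symp_add_right, symp_self, symp_comm (τ (ρ 0)) (τ 0)]
          grind
        change (τ (ρ w.1) + τ (ρ 0), w.2 + ((0 : ZMod 2), symp (τ (ρ 0)) (τ (ρ w.1)))) =
          (τ (ρ w.1 + ρ 0) + τ 0, w.2 + (0, symp (ρ 0) (ρ w.1)) +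
            (0, symp (τ 0) (τ (ρ w.1 + ρ 0))))
        rw [h1, h3, add_assoc]
        exact Prod.ext rfl (congrArg (w.2 + ·) (Prod.ext (add_zero 0).symm rfl)) }

theorem affinePerm_apply (τ : Equiv.Perm Plane) (w : Plane × Plane) :
    affinePerm τ w = (τ w.1 + τ 0, w.2 + (0, symp (τ 0) (τ w.1))) := rfl

/-- The copy of `S₄` in the automorphism group of the model. -/
def affineHom : Equiv.Perm Plane →* modelAut :=
  affinePerm.codRestrict modelAut <|
  range_le_modelAut _ (fun τ => by
    change (τ 0 + τ 0, (0 : Plane) + (0, symp (τ 0) (τ 0))) = 0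
    rw [plane_add_self, symp_self]; rfl)
    fun τ u v => by
      refine ⟨u, τ.symm (u.1 • τ 0 + v + τ 0), funext fun w => ?_⟩
      have h := symp_perm τ (τ.symm (u.1 • τ 0 + v + τ 0)) w.1
      rw [Equiv.apply_symm_apply, add_assoc, plane_add_self, add_zero, symp_add_left] at h
      have h1 : symp (u.1 • τ 0) (τ w.1 + τ 0) = u.1 * symp (τ 0) (τ w.1) := by
        rw [← symp_perm_fixed τ w.1]
        simp [symp]
        ring
      simp only [modelFun, Function.comp_apply, affinePerm_apply, nz_perm, symp_add_right u,
        ← h, h1]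
      simp only [symp]
      ring

/-- The shears of the 16-element space along the first coordinate direction. -/
def shearPerm : Multiplicative Plane →* Equiv.Perm (Plane × Plane) :=
  MonoidHom.toHomPerm
    { toFun := fun n w => (w.1, w.2 + (symp n.toAdd w.1, 0))
      map_one' := funext fun w => by
        change (w.1, w.2 + (symp 0 w.1, (0 : ZMod 2))) = w
        rw [symp_zero_left, Prod.mk_zero_zero, add_zero]
      map_mul' := fun m n => by
        funext w
        change (w.1, w.2 + (symp (m.toAdd + n.toAdd) w.1, (0 : ZMod 2))) =
          (w.1, w.2 + (symp n.toAdd w.1, (0 : ZMod 2)) + (symp m.toAdd w.1, 0))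
        rw [symp_add_left, add_assoc, add_comm (symp m.toAdd _)]
        exact Prod.ext rfl (congrArg (w.2 + ·) (Prod.ext rfl (add_zero 0).symm)) }

theorem shearPerm_apply (n : Multiplicative Plane) (w : Plane × Plane) :
    shearPerm n w = (w.1, w.2 + (symp n.toAdd w.1, 0)) := rfl

/-- The copy of the Klein four-group in the automorphism group of the model. -/
def shearHom : Multiplicative Plane →* modelAut :=
  shearPerm.codRestrict modelAut <|
  range_le_modelAut _ (fun n => by simp [shearPerm_apply, symp_zero_right])
    fun n u v => by
      refine ⟨u, v + u.2 • n.toAdd, funext fun w => ?_⟩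
      simp [modelFun, symp, shearPerm_apply]
      ring

theorem affineHom_apply (τ : Equiv.Perm Plane) (w : Plane × Plane) :
    (affineHom τ : Equiv.Perm (Plane × Plane)) w =
      (τ w.1 + τ 0, w.2 + (0, symp (τ 0) (τ w.1))) := rfl

theorem shearHom_apply (n : Multiplicative Plane) (w : Plane × Plane) :
    (shearHom n : Equiv.Perm (Plane × Plane)) w = (w.1, w.2 + (symp n.toAdd w.1, 0)) := rfl

theorem complementHom_apply (π : Equiv.Perm {y : Plane // y ≠ 0}) (w : Plane × Plane) :
    (complementHom π : Equiv.Perm (Plane × Plane)) w = (w.1, Equiv.Perm.ofSubtype π w.2) := rfl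

theorem fst_zero_of_mem {φ : Equiv.Perm (Plane × Plane)} (hφ : φ ∈ modelAut) (y : Plane) :
    (φ (0, y)).1 = 0 := by
  rw [fst_eq_of_mem hφ 0 y 0]
  exact congrArg Prod.fst hφ.1

/-- The action of the automorphism group of the model on the zero fiber. -/
def fiberHom : modelAut →* Function.End Plane where
  toFun φ y := ((φ : Equiv.Perm (Plane × Plane)) (0, y)).2
  map_one' := rfl
  map_mul' φ ψ := by
    funext y
    change (φ.1 (ψ.1 (0, y))).2 = (φ.1 (0, (ψ.1 (0, y)).2)).2
    conv_lhs => rw [← Prod.mk.eta (p := ψ.1 (0, y)), fst_zero_of_mem ψ.2]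

theorem fiberHom_apply (φ : modelAut) (y : Plane) :
    fiberHom φ y = ((φ : Equiv.Perm (Plane × Plane)) (0, y)).2 := rfl

theorem complementHom_eq_one_of_fiberHom (π : Equiv.Perm {y : Plane // y ≠ 0})
    (h : fiberHom (complementHom π) = 1) : π = 1 := by
  apply Equiv.Perm.ofSubtype_injective
  rw [map_one]
  exact Equiv.ext fun y => congrFun h y

theorem exists_fiberHom_complementHom (φ : modelAut) :
    ∃ π, fiberHom φ = fiberHom (complementHom π) := by
  have hinj : Function.Injective (fiberHom φ) := fun y z h => by
    have : φ.1 (0, y) = φ.1 (0, z) := Prod.ext (fst_eq_of_mem φ.2 _ _ _) h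
    simpa using φ.1.injective this
  let β : Equiv.Perm Plane := Equiv.ofBijective _ (Finite.injective_iff_bijective.1 hinj)
  have h0 : β 0 = 0 := congrArg Prod.snd φ.2.1
  have hβ : ∀ y, β y ≠ 0 ↔ y ≠ 0 := fun y => by
    rw [Ne, ← h0, β.injective.eq_iff, h0]
  refine ⟨β.subtypePerm hβ, ?_⟩
  funext y
  rw [fiberHom_apply (complementHom _), complementHom_apply,
    Equiv.Perm.ofSubtype_subtypePerm hβ]
  · rfl
  · rintro y hy rfl
    exact hy h0

theorem fiberHom_affineHom (τ : Equiv.Perm Plane) : fiberHom (affineHom τ) = 1 := by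
  funext y
  rw [fiberHom_apply, affineHom_apply, symp_self, Prod.mk_zero_zero, add_zero]
  rfl

theorem fiberHom_shearHom (n : Multiplicative Plane) : fiberHom (shearHom n) = 1 := by
  funext y
  rw [fiberHom_apply, shearHom_apply, symp_zero_right, Prod.mk_zero_zero, add_zero]
  rfl

theorem shearHom_injective : Function.Injective shearHom := by
  refine (injective_iff_map_eq_one _).2 fun n hn => symp_nondegenerate _ _ fun x => ?_
  have h := congrArg (fun φ : modelAut => (φ.1 (x, 0)).2.1) hn
  have hx : symp n.toAdd x = 0 := by simpa [shearHom_apply] using h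
  exact hx.trans (symp_zero_left x).symm

theorem eq_one_of_affineHom_eq_shearHom {τ : Equiv.Perm Plane} {n : Multiplicative Plane}
    (h : affineHom τ = shearHom n) : τ = 1 := by
  have hw : ∀ w : Plane × Plane, (τ w.1 + τ 0, w.2 + (0, symp (τ 0) (τ w.1))) =
      (w.1, w.2 + (symp n.toAdd w.1, 0)) := fun w =>
    congrArg (fun φ : modelAut => φ.1 w) h
  have h0 : τ 0 = 0 := symp_nondegenerate _ _ fun x => by
    have := congrArg (fun w => w.2.2) (hw (τ.symm x, 0))
    simpa [symp_zero_left] using this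
  ext1 x
  have := congrArg Prod.fst (hw (x, 0))
  simpa [h0] using this

theorem affineHom_injective : Function.Injective affineHom :=
  (injective_iff_map_eq_one _).2 fun _ hτ =>
    eq_one_of_affineHom_eq_shearHom (hτ.trans (map_one shearHom).symm)

theorem affineHom_mul_shearHom (τ : Equiv.Perm Plane) (n : Multiplicative Plane) :
    affineHom τ * shearHom n =
      shearHom (Multiplicative.ofAdd (τ n.toAdd + τ 0)) * affineHom τ := by
  ext1
  ext1 w
  change (τ w.1 + τ 0, w.2 + (symp n.toAdd w.1, (0 : ZMod 2)) + (0, symp (τ 0) (τ w.1))) =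
    (τ w.1 + τ 0, w.2 + (0, symp (τ 0) (τ w.1)) +
      (symp (τ n.toAdd + τ 0) (τ w.1 + τ 0), (0 : ZMod 2)))
  rw [symp_perm, add_right_comm]

theorem exists_eq_shearHom_mul_affineHom (φ : modelAut) (h : fiberHom φ = 1) :
    ∃ n τ, φ = shearHom n * affineHom τ := by
  have hadd : ∀ x y, φ.1 (x + y, 0) = φ.1 (x, 0) + φ.1 (y, 0) := fun x y => by
    rw [← map_add_of_mem φ.2]
    exact congrArg φ.1 (Prod.ext rfl (add_zero 0).symm)
  have hφ : ∀ w : Plane × Plane, φ.1 w = φ.1 (w.1, 0) + (0, w.2) := fun w => by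
    have h1 : φ.1 (0, w.2) = (0, w.2) := Prod.ext (fst_zero_of_mem φ.2 _) (congrFun h w.2)
    rw [← h1, ← map_add_of_mem φ.2, Prod.mk_add_mk, add_zero, zero_add]
  let A : Plane → Plane := fun x => (φ.1 (x, 0)).1
  have hA : ∀ x y, A (x + y) = A x + A y := fun x y => congrArg Prod.fst (hadd x y)
  have hinj : Function.Injective A := fun x y hxy => by
    have h1 : A (x + y) = 0 := by rw [hA, hxy, plane_add_self]
    have h2 : nz (x + y) = 0 := by
      rw [← nz_fst φ.2 (x + y, 0)]
      exact (congrArg nz h1).trans (by simp [nz])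
    have h3 : x + y = 0 := by
      rw [nz_eq] at h2
      by_contra h4
      simp [h4] at h2
    rwa [← CharTwo.sub_eq_add, sub_eq_zero] at h3
  let α : Equiv.Perm Plane := Equiv.ofBijective A (Finite.injective_iff_bijective.1 hinj)
  have hα : ∀ x, (φ.1 (x, 0)).1 = α x := fun x => rfl
  have hsymm : ∀ x y, α.symm (x + y) = α.symm x + α.symm y := fun x y => by
    rw [Equiv.symm_apply_eq]
    change _ = A _
    rw [hA]
    exact (congrArg₂ _ (α.apply_symm_apply x) (α.apply_symm_apply y)).symm
  obtain ⟨n, hn⟩ := exists_symp_eq (fun x => (φ.1 (α.symm x, 0)).2.1) fun x y => by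
    simp only [hsymm, hadd, Prod.snd_add, Prod.fst_add]
  obtain ⟨t, ht⟩ := exists_symp_eq (fun x => (φ.1 (α.symm x, 0)).2.2) fun x y => by
    simp only [hsymm, hadd, Prod.snd_add]
  refine ⟨Multiplicative.ofAdd n, α.trans (Equiv.addRight t), ?_⟩
  have hα0 : α 0 = 0 := congrArg Prod.fst φ.2.1
  ext1
  ext1 w
  rw [hφ]
  change _ = (α w.1 + t + (α 0 + t), w.2 + ((0 : ZMod 2), symp (α 0 + t) (α w.1 + t)) +
    (symp n (α w.1 + t + (α 0 + t)), (0 : ZMod 2)))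
  have h1 := hn (α w.1)
  have h2 := ht (α w.1)
  simp only [Equiv.symm_apply_apply] at h1 h2
  rw [hα0, zero_add, add_assoc, plane_add_self, add_zero, symp_add_right t, symp_self,
    add_zero, ← h1, ← h2]
  refine Prod.ext ?_ (Prod.ext ?_ ?_)
  · simp [hα]
  · simp [add_comm]
  · simp [add_comm]

/-- A group-theoretic criterion for iterated semidirect decompositions. -/
theorem exists_semidirect_decomposition {G Q R S A : Type*} [Group G] [Monoid Q] [Group R]
    [Group S] [Group A] (p : G →* Q) (a : R →* G) (b : S →* G) (c : A →* G)
    (ha : ∀ r, p (a r) = 1 → r = 1) (hpa : ∀ g, ∃ r, p g = p (a r))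
    (hb : Function.Injective b) (hc : Function.Injective c)
    (hpb : ∀ s, p (b s) = 1) (hpc : ∀ n, p (c n) = 1)
    (hbc : ∀ s n, b s = c n → s = 1) (hcov : ∀ g, p g = 1 → ∃ n s, g = c n * b s)
    (hnorm : ∀ s n, ∃ n', b s * c n = c n' * b s) :
    ∃ N H : Subgroup G,
      N.Normal ∧ Nonempty (H ≃* R) ∧ N ⊓ H = ⊥ ∧ (∀ g, ∃ n ∈ N, ∃ h ∈ H, g = n * h) ∧
      ∃ N₀ K : Subgroup G,
        N₀ ≤ N ∧ K ≤ N ∧ (∀ g ∈ N, ∀ n ∈ N₀, g * n * g⁻¹ ∈ N₀) ∧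
        Nonempty (N₀ ≃* A) ∧ Nonempty (K ≃* S) ∧ N₀ ⊓ K = ⊥ ∧
        (∀ g ∈ N, ∃ n ∈ N₀, ∃ k ∈ K, g = n * k) := by
  have hainj : Function.Injective a :=
    (injective_iff_map_eq_one _).2 fun r hr => ha r (by rw [hr, map_one])
  refine ⟨p.ker, a.range, inferInstance, ⟨(MonoidHom.ofInjective hainj).symm⟩, ?_, ?_,
    c.range, b.range, ?_, ?_, ?_, ⟨(MonoidHom.ofInjective hc).symm⟩,
    ⟨(MonoidHom.ofInjective hb).symm⟩, ?_, ?_⟩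
  · rw [eq_bot_iff]
    rintro _ ⟨hr, r, rfl⟩
    rw [ha r hr, map_one]
    exact one_mem _
  · intro g
    obtain ⟨r, hr⟩ := hpa g
    refine ⟨g * (a r)⁻¹, ?_, a r, ⟨r, rfl⟩, by group⟩
    rw [MonoidHom.mem_ker, map_mul, hr, ← map_mul, mul_inv_cancel, map_one]
  · rintro _ ⟨n, rfl⟩
    exact hpc n
  · rintro _ ⟨s, rfl⟩
    exact hpb s
  · rintro g hg _ ⟨n, rfl⟩
    obtain ⟨m, s, rfl⟩ := hcov g hg
    obtain ⟨n', hn'⟩ := hnorm s n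
    refine ⟨m * n' * m⁻¹, ?_⟩
    rw [mul_assoc (c m), hn']
    simp only [map_mul, map_inv, mul_inv_rev]
    group
  · rw [eq_bot_iff]
    rintro _ ⟨⟨n, rfl⟩, s, hs⟩
    rw [← hs, hbc s n hs, map_one]
    exact one_mem _
  · intro g hg
    obtain ⟨n, s, rfl⟩ := hcov g hg
    exact ⟨c n, ⟨n, rfl⟩, b s, ⟨s, rfl⟩, rfl⟩

theorem exists_decomposition_of_mulEquiv {G : Type*} [Group G] (ψ : modelAut ≃* G) :
    ∃ N H : Subgroup G,
      N.Normal ∧ Nonempty (H ≃* Equiv.Perm (Fin 3)) ∧ N ⊓ H = ⊥ ∧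
      (∀ g, ∃ n ∈ N, ∃ h ∈ H, g = n * h) ∧
      ∃ N₀ K : Subgroup G,
        N₀ ≤ N ∧ K ≤ N ∧ (∀ g ∈ N, ∀ n ∈ N₀, g * n * g⁻¹ ∈ N₀) ∧
        Nonempty (N₀ ≃* Multiplicative (ZMod 2 × ZMod 2)) ∧
        Nonempty (K ≃* Equiv.Perm (Fin 4)) ∧ N₀ ⊓ K = ⊥ ∧
        (∀ g ∈ N, ∃ n ∈ N₀, ∃ k ∈ K, g = n * k) := by
  let e₃ : Equiv.Perm (Fin 3) ≃* Equiv.Perm {y : Plane // y ≠ 0} :=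
    Equiv.permCongrHom (Fintype.equivFinOfCardEq (by decide)).symm
  let e₄ : Equiv.Perm (Fin 4) ≃* Equiv.Perm Plane :=
    Equiv.permCongrHom (Fintype.equivFinOfCardEq (by decide)).symm
  refine exists_semidirect_decomposition (fiberHom.comp ψ.symm.toMonoidHom)
    ((ψ.toMonoidHom.comp complementHom).comp e₃.toMonoidHom)
    ((ψ.toMonoidHom.comp affineHom).comp e₄.toMonoidHom) (ψ.toMonoidHom.comp shearHom)
    (fun r hr => ?_) (fun g => ?_)
    ((ψ.injective.comp affineHom_injective).comp e₄.injective)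
    (ψ.injective.comp shearHom_injective)
    (fun s => ?_) (fun n => ?_) (fun s n h => ?_) (fun g hg => ?_) fun s n => ?_
  · apply e₃.injective
    rw [map_one]
    exact complementHom_eq_one_of_fiberHom _ (by simpa using hr)
  · obtain ⟨π, hπ⟩ := exists_fiberHom_complementHom (ψ.symm g)
    exact ⟨e₃.symm π, by simpa using hπ⟩
  · simpa using fiberHom_affineHom _
  · simpa using fiberHom_shearHom _
  · apply e₄.injective
    rw [map_one]
    exact eq_one_of_affineHom_eq_shearHom (ψ.injective h)
  · obtain ⟨n, τ, h⟩ := exists_eq_shearHom_mul_affineHom _ hg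
    refine ⟨n, e₄.symm τ, ?_⟩
    exact ((ψ.apply_symm_apply g).symm.trans (congrArg ψ h)).trans (by simp)
  · exact ⟨Multiplicative.ofAdd (e₄ s n.toAdd + e₄ s 0), by
      simpa only [map_mul] using! congrArg ψ (affineHom_mul_shearHom (e₄ s) n)⟩

/-- The sign character of the field with two elements. -/
def sgn (t : ZMod 2) : ℤ := if t = 0 then 1 else -1

theorem sgn_add (s t : ZMod 2) : sgn (s + t) = sgn s * sgn t := by
  revert s t; decide

theorem sgn_injective : Function.Injective sgn := by decide

theorem sum_plane (T : Plane → ℤ) :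
    ∑ x, T x = T 0 + T (0, 1) + T (1, 0) + T (1, 1) := by
  have : (Finset.univ : Finset Plane) = {0, (0, 1), (1, 0), (1, 1)} := by decide
  rw [this, Finset.sum_insert (by decide), Finset.sum_insert (by decide),
    Finset.sum_pair (by decide)]
  ring

theorem forall_plane {P : Plane → Prop} :
    (∀ x, P x) ↔ P 0 ∧ P (0, 1) ∧ P (1, 0) ∧ P (1, 1) := by
  refine ⟨fun h => ⟨h _, h _, h _, h _⟩, fun ⟨h0, h1, h2, h3⟩ x => ?_⟩
  have hx : ∀ x : Plane, x = 0 ∨ x = (0, 1) ∨ x = (1, 0) ∨ x = (1, 1) := by decide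
  obtain rfl | rfl | rfl | rfl := hx x <;> assumption

theorem eq_zero_of_fourier (T : Plane → ℤ) (h : ∀ v, ∑ x, sgn (symp v x) * T x = 0)
    (x : Plane) : T x = 0 := by
  revert x
  simp only [sum_plane, forall_plane] at h ⊢
  simp [symp, sgn, CharTwo.add_self_eq_zero] at h
  grind

theorem fourier_concentrated (T : Plane → ℤ)
    (h : ∀ u ≠ (1, 1), ∑ y, sgn (symp u y) * T y = 0) (y : Plane) :
    T y = sgn (symp (1, 1) y) * T 0 := by
  have h0 := h 0 (by decide)
  have h1 := h (0, 1) (by decide)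
  have h2 := h (1, 0) (by decide)
  revert y
  simp only [sum_plane, forall_plane] at h0 h1 h2 ⊢
  simp [symp, sgn, CharTwo.add_self_eq_zero] at h0 h1 h2 ⊢
  grind

theorem apply_eq_of_balanced (G : Plane × Plane → ZMod 2)
    (h : ∀ u ≠ (1, 1), ∀ v, ∑ w, sgn (G w + symp u w.2 + symp v w.1) = 0) (x y : Plane) :
    G (x, y) = symp (1, 1) y + G (x, 0) := by
  apply sgn_injective
  rw [sgn_add]
  refine fourier_concentrated (fun y => sgn (G (x, y))) (fun u hu => ?_) y
  refine eq_zero_of_fourier (fun x => ∑ y, sgn (symp u y) * sgn (G (x, y))) (fun v => ?_) x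
  refine Eq.trans ?_ (h u hu v)
  rw [Fintype.sum_prod_type (α₁ := Plane)]
  refine Finset.sum_congr rfl fun x _ => ?_
  rw [Finset.mul_sum]
  refine Finset.sum_congr rfl fun y _ => ?_
  simp only [sgn_add]
  ring

theorem surjective_of_balanced {X : Type*} [Fintype X] (hX : Fintype.card X = 16)
    (p : X → Plane × Plane)
    (h : ∀ u v, (u, v) ≠ 0 → ∑ x, sgn (symp u (p x).2 + symp v (p x).1) = 0) :
    Function.Surjective p := by
  intro w
  by_contra! hw
  have h1 : ∑ z : Plane × Plane, ∑ x,
      sgn (symp z.1 (p x + w).2 + symp z.2 (p x + w).1) = 16 := by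
    rw [Finset.sum_eq_single 0]
    · simp [symp, sgn, hX]
    · rintro ⟨u, v⟩ - hz
      have : ∀ x, sgn (symp u (p x + w).2 + symp v (p x + w).1) =
          sgn (symp u (p x).2 + symp v (p x).1) * sgn (symp u w.2 + symp v w.1) := fun x => by
        simp only [← sgn_add, Prod.fst_add, Prod.snd_add, symp_add_right]
        congr 1
        ring
      simp only [this, ← Finset.sum_mul, h u v hz, zero_mul]
    · simp
  have key : ∀ d : Plane × Plane, d ≠ 0 →
      ∑ z : Plane × Plane, sgn (symp z.1 d.2 + symp z.2 d.1) = 0 := by decide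
  rw [Finset.sum_comm, Finset.sum_eq_zero fun x _ => ?_] at h1
  · norm_num at h1
  · refine key _ fun h => hw x ?_
    rwa [← CharTwo.sub_eq_add, sub_eq_zero] at h

theorem exists_quadratic (s : Plane → ZMod 2) (h0 : s 0 = 0) :
    ∃ l ε, ∀ x, s x = symp l x + ε * nz x := by
  refine ⟨(s (1, 0) + s (1, 1), s (0, 1) + s (1, 1)), s (0, 1) + s (1, 0) + s (1, 1),
    forall_plane.2 ⟨?_, ?_, ?_, ?_⟩⟩
  · simp [h0, symp, nz]
  all_goals
    simp [symp, nz, CharTwo.add_self_eq_zero]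
    grind

/-- A family of functions interpolating between the linear family and `modelFun`. -/
def normalFun (ε : ZMod 2) (u v : Plane) (w : Plane × Plane) : ZMod 2 :=
  symp u w.2 + symp v w.1 + ε * (u.1 * u.2) * nz w.1

theorem normalFun_injective (ε : ZMod 2) :
    Function.Injective fun z : Plane × Plane => normalFun ε z.1 z.2 := by
  rintro ⟨u, v⟩ ⟨u', v'⟩ h
  have hu : u = u' := symp_nondegenerate _ _ fun y => by
    simpa [normalFun, symp_zero_right, nz] using congrFun h (0, y)
  subst hu
  have hv : v = v' := symp_nondegenerate _ _ fun x => by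
    simpa [normalFun] using congrFun h (x, 0)
  rw [hv]

section Classification

variable {X : Type*} [Fintype X] {F : Finset (X → ZMod 2)}

/-- A code of 16 balanced functions with a plane of periods has the shape `normalFun`. -/
theorem exists_normal_form (hX : Fintype.card X = 16) (hF : F.card = 16) (h0 : 0 ∈ F) (o : X)
    (ho : ∀ f ∈ F, f o = 0)
    (hbal : ∀ f ∈ F, ∀ g ∈ F, f ≠ g → ∑ x, sgn (f x + g x) = 0)
    {c₁ c₂ : X → ZMod 2} (hc₁ : c₁ ≠ 0) (hc₂ : c₂ ≠ 0) (hc : c₁ ≠ c₂)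
    (hc₁F : ∀ f ∈ F, c₁ + f ∈ F) (hc₂F : ∀ f ∈ F, c₂ + f ∈ F) :
    ∃ (ε : ZMod 2) (e : X ≃ Plane × Plane), e o = 0 ∧
      ∀ f, f ∈ F ↔ ∃ u v, f = normalFun ε u v ∘ e := by
  let C : Plane → X → ZMod 2 := fun v x => symp v (c₁ x, c₂ x)
  have hCadd : ∀ u v x, C (u + v) x = C u x + C v x := fun u v x => symp_add_left _ _ _
  have hC0 : C 0 = 0 := funext fun x => symp_zero_left _
  have hC1 : C (0, 1) = c₁ := by funext x; simp [C, symp]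
  have hC2 : C (1, 0) = c₂ := by funext x; simp [C, symp]
  have hC3 : C (1, 1) = c₂ + c₁ := by funext x; simp [C, symp]
  have hCF : ∀ f ∈ F, ∀ v, C v + f ∈ F := fun f hf => by
    rw [forall_plane, hC0, hC1, hC2, hC3, zero_add, add_assoc]
    exact ⟨hf, hc₁F f hf, hc₂F f hf, hc₂F _ (hc₁F f hf)⟩
  have hCne : ∀ v ≠ 0, C v ≠ 0 := by
    rw [forall_plane, hC1, hC2, hC3]
    refine ⟨fun h => absurd rfl h, fun _ => hc₁, fun _ => hc₂, fun _ h => hc ?_⟩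
    exact funext fun x => (CharTwo.add_eq_zero.1 (congrFun h x)).symm
  have coset : ∀ S : Finset (X → ZMod 2), S.card < 16 → ∃ g ∈ F, g ∉ S := fun S hS =>
    Finset.exists_mem_notMem_of_card_lt_card (by rwa [hF])
  have hbalC : ∀ f ∈ F, ∀ g ∈ F, g ∉ Finset.univ.image (fun v => C v + f) →
      ∀ v, ∑ x, sgn (g x + f x + C v x) = 0 := by
    intro f hf g hg hfg v
    rw [← hbal g hg (C v + f) (hCF f hf v) fun h => hfg (by simp [h])]
    refine Finset.sum_congr rfl fun x _ => congrArg sgn ?_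
    simp only [Pi.add_apply]
    ring
  have hcard : ∀ f : X → ZMod 2, (Finset.univ.image fun v => C v + f).card ≤ 4 := fun f =>
    Finset.card_image_le.trans (by decide)
  obtain ⟨g₁, hg₁, hg₁'⟩ := coset (Finset.univ.image fun v => C v + 0)
    ((hcard 0).trans_lt (by norm_num))
  obtain ⟨g₂, hg₂, hg₂'⟩ := coset ((Finset.univ.image fun v => C v + 0) ∪
    Finset.univ.image fun v => C v + g₁) (by
      have := Finset.card_union_le (Finset.univ.image fun v => C v + 0)
        (Finset.univ.image fun v => C v + g₁)
      have := hcard 0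
      have := hcard g₁
      omega)
  obtain ⟨g₃, hg₃, hg₃'⟩ := coset ((Finset.univ.image fun v => C v + 0) ∪
    (Finset.univ.image fun v => C v + g₁) ∪ Finset.univ.image fun v => C v + g₂) (by
      have := Finset.card_union_le (Finset.univ.image fun v => C v + 0)
        (Finset.univ.image fun v => C v + g₁)
      have := Finset.card_union_le ((Finset.univ.image fun v => C v + 0) ∪
        Finset.univ.image fun v => C v + g₁) (Finset.univ.image fun v => C v + g₂)
      have := hcard 0
      have := hcard g₁
      have := hcard g₂
      omega)
  rw [Finset.notMem_union] at hg₂' hg₃'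
  rw [Finset.notMem_union] at hg₃'
  obtain ⟨⟨hg₃0, hg₃1⟩, hg₃2⟩ := hg₃'
  let p : X → Plane × Plane := fun x => ((c₁ x, c₂ x), (g₁ x, g₂ x))
  have hp : Function.Bijective p := by
    refine (Fintype.bijective_iff_surjective_and_card p).2
      ⟨surjective_of_balanced hX p fun u v => ?_, by rw [hX]; rfl⟩
    revert u v
    rw [forall_plane]
    refine ⟨fun v hv => ?_, fun v _ => ?_, fun v _ => ?_, fun v _ => ?_⟩
    · have hv0 : v ≠ 0 := by rintro rfl; exact hv rfl
      rw [← hbal _ (by simpa using hCF 0 h0 v) 0 h0 (hCne v hv0)]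
      simp [p, C, symp_zero_left]
    · rw [← hbalC 0 h0 g₁ hg₁ hg₁' v]
      simp [p, C, symp]
    · rw [← hbalC 0 h0 g₂ hg₂ hg₂'.1 v]
      simp [p, C, symp]
    · rw [← hbalC g₁ hg₁ g₂ hg₂ hg₂'.2 v]
      simp [p, C, symp]
  let e : X ≃ Plane × Plane := Equiv.ofBijective p hp
  have he : ∀ x, e x = ((c₁ x, c₂ x), (g₁ x, g₂ x)) := fun _ => rfl
  have heo : e o = 0 := by
    rw [he, ho g₁ hg₁, ho g₂ hg₂, ho c₁ (by simpa using hc₁F 0 h0),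
      ho c₂ (by simpa using hc₂F 0 h0)]
    rfl
  have hG := apply_eq_of_balanced (g₃ ∘ e.symm) fun u hu v => by
    rw [← e.sum_comp]
    simp only [Function.comp_apply, Equiv.symm_apply_apply]
    revert u v
    rw [forall_plane]
    refine ⟨fun _ v => ?_, fun _ v => ?_, fun _ v => ?_, fun h => absurd rfl h⟩
    · rw [← hbalC 0 h0 g₃ hg₃ hg₃0 v]
      simp [he, C, symp_zero_left]
    · rw [← hbalC g₁ hg₁ g₃ hg₃ hg₃1 v]
      simp [he, C, symp]
    · rw [← hbalC g₂ hg₂ g₃ hg₃ hg₃2 v]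
      simp [he, C, symp]
  obtain ⟨l, ε, hl⟩ := exists_quadratic (fun x => (g₃ ∘ e.symm) (x, 0)) (by
    have : e.symm 0 = o := by rw [Equiv.symm_apply_eq, heo]
    change g₃ (e.symm 0) = 0
    rw [this, ho g₃ hg₃])
  have hg₃e : ∀ x, g₃ x = symp (1, 1) (e x).2 + symp l (e x).1 + ε * nz (e x).1 := fun x => by
    have := hG (e x).1 (e x).2
    rw [hl, Prod.mk.eta, Function.comp_apply, Equiv.symm_apply_apply] at this
    rw [this, add_assoc]
  have hmem : ∀ u v, normalFun ε u v ∘ e ∈ F := by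
    rw [forall_plane]
    refine ⟨fun v => ?_, fun v => ?_, fun v => ?_, fun v => ?_⟩
    · convert hCF 0 h0 v using 1
      funext x
      simp [normalFun, he, C, symp_zero_left]
    · convert hCF g₁ hg₁ v using 1
      funext x
      simp [normalFun, he, C, symp]
      ring
    · convert hCF g₂ hg₂ v using 1
      funext x
      simp [normalFun, he, C, symp]
      ring
    · convert hCF g₃ hg₃ (v + l) using 1
      funext x
      have h2 := CharTwo.add_self_eq_zero (symp l (c₁ x, c₂ x))
      rw [Pi.add_apply, hCadd, hg₃e]
      simp only [normalFun, Function.comp_apply, he, C]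
      linear_combination -h2
  have himage : (Finset.univ.image fun z : Plane × Plane => normalFun ε z.1 z.2 ∘ e) = F := by
    refine Finset.eq_of_subset_of_card_le ?_ ?_
    · simp only [Finset.image_subset_iff]
      exact fun z _ => hmem z.1 z.2
    · rw [Finset.card_image_of_injective, hF]
      · decide
      · exact e.surjective.injective_comp_right.comp (normalFun_injective ε)
  refine ⟨ε, e, heo, fun f => ?_⟩
  rw [← himage]
  simp [eq_comm]

/-- If moreover the family is not closed under addition, then it is the model family. -/
theorem exists_model_form (hX : Fintype.card X = 16) (hF : F.card = 16) (h0 : 0 ∈ F) (o : X)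
    (ho : ∀ f ∈ F, f o = 0)
    (hbal : ∀ f ∈ F, ∀ g ∈ F, f ≠ g → ∑ x, sgn (f x + g x) = 0)
    {c₁ c₂ : X → ZMod 2} (hc₁ : c₁ ≠ 0) (hc₂ : c₂ ≠ 0) (hc : c₁ ≠ c₂)
    (hc₁F : ∀ f ∈ F, c₁ + f ∈ F) (hc₂F : ∀ f ∈ F, c₂ + f ∈ F)
    (hnot : ¬ ∀ f ∈ F, ∀ g ∈ F, f + g ∈ F) :
    ∃ e : X ≃ Plane × Plane, e o = 0 ∧ ∀ f, f ∈ F ↔ ∃ u v, f = modelFun u v ∘ e := by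
  obtain ⟨ε, e, heo, he⟩ := exists_normal_form hX hF h0 o ho hbal hc₁ hc₂ hc hc₁F hc₂F
  have hε : ε = 1 := by
    refine (by decide : ∀ ε : ZMod 2, ε ≠ 0 → ε = 1) ε ?_
    rintro rfl
    refine hnot fun f hf g hg => ?_
    obtain ⟨u, v, rfl⟩ := (he f).1 hf
    obtain ⟨u', v', rfl⟩ := (he g).1 hg
    refine (he _).2 ⟨u + u', v + v', funext fun x => ?_⟩
    simp [normalFun, symp_add_left]
    ring
  subst hε
  let T : Plane × Plane → Plane × Plane := fun w => (w.1, w.2 + (nz w.1, nz w.1))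
  have hT : Function.Involutive T := fun w => by
    simp only [T, add_assoc, plane_add_self, add_zero]
  refine ⟨e.trans hT.toPerm, ?_, fun f => ?_⟩
  · simp [heo, T, nz]
  · rw [he]
    have : ∀ u v, normalFun 1 u v ∘ e = modelFun u v ∘ e.trans hT.toPerm := fun u v => by
      funext x
      have h1 := CharTwo.add_self_eq_zero (u.1 * nz (e x).1)
      have h2 := CharTwo.add_self_eq_zero (u.2 * nz (e x).1)
      simp only [normalFun, modelFun, Function.comp_apply, Equiv.trans_apply,
        Function.Involutive.coe_toPerm, T, symp_add_right]
      simp only [nz, symp] at h1 h2 ⊢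
      linear_combination -h1 - h2
    simp only [this]

end Classification

/-- The indicator function of a set of points, extended by zero to an extra point. -/
def blockFun (b : Finset (Fin 15)) (x : Option (Fin 15)) : ZMod 2 :=
  x.elim 0 fun i => if i ∈ b then 1 else 0

theorem blockFun_empty : blockFun ∅ = 0 := by
  funext x
  cases x <;> simp [blockFun]

theorem blockFun_injective : Function.Injective blockFun := by
  intro b b' h
  ext i
  have := congrFun h (some i)
  by_cases h1 : i ∈ b <;> by_cases h2 : i ∈ b' <;> simp_all [blockFun]

theorem blockFun_symmDiff (b b' : Finset (Fin 15)) :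
    blockFun (symmDiff b b') = blockFun b + blockFun b' := by
  funext x
  cases x with
  | none => simp [blockFun]
  | some i =>
    by_cases h1 : i ∈ b <;> by_cases h2 : i ∈ b' <;>
      simp [blockFun, Finset.mem_symmDiff, h1, h2, CharTwo.add_self_eq_zero]

theorem sum_sgn_blockFun (b : Finset (Fin 15)) :
    ∑ x, sgn (blockFun b x) = 16 - 2 * b.card := by
  have : ∀ i, sgn (blockFun b (some i)) = 1 - 2 * if i ∈ b then 1 else 0 := fun i => by
    by_cases h : i ∈ b <;> simp [blockFun, sgn, h]
  rw [Fintype.sum_option]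
  simp only [this, Finset.sum_sub_distrib, ← Finset.mul_sum]
  simp [blockFun, sgn]
  ring

theorem blockFun_image (σ : Equiv.Perm (Fin 15)) (b : Finset (Fin 15)) :
    blockFun (b.image σ) ∘ σ.optionCongr = blockFun b := by
  funext x
  cases x <;> simp [blockFun]

/-- The functions of the blocks, together with the zero function. -/
def blockCode (B : Finset (Finset (Fin 15))) : Finset (Option (Fin 15) → ZMod 2) :=
  (insert ∅ B).image blockFun

variable {B : Finset (Finset (Fin 15))}

theorem blockFun_mem_blockCode {b : Finset (Fin 15)} :
    blockFun b ∈ blockCode B ↔ b = ∅ ∨ b ∈ B := by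
  rw [blockCode, Finset.mem_image]
  simp [blockFun_injective.eq_iff]

theorem mem_blockCode {f : Option (Fin 15) → ZMod 2} :
    f ∈ blockCode B ↔ ∃ b, (b = ∅ ∨ b ∈ B) ∧ blockFun b = f := by
  rw [blockCode, Finset.mem_image]
  simp only [Finset.mem_insert]

theorem empty_notMem_of_isDesign (hD : IsDesign B) : ∅ ∉ B := fun h => by
  simpa using hD.2.1 _ h

theorem card_symmDiff_of_isDesign (hD : IsDesign B) {b b' : Finset (Fin 15)}
    (hb : b = ∅ ∨ b ∈ B) (hb' : b' = ∅ ∨ b' ∈ B) (h : b ≠ b') :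
    (symmDiff b b').card = 8 := by
  obtain ⟨-, h8, h4⟩ := hD
  rcases hb with rfl | hb <;> rcases hb' with rfl | hb'
  · exact absurd rfl h
  · rw [← Finset.bot_eq_empty, bot_symmDiff, h8 _ hb']
  · rw [← Finset.bot_eq_empty, symmDiff_bot, h8 _ hb]
  · have h1 := Finset.card_sdiff_add_card_inter b b'
    have h2 := Finset.card_sdiff_add_card_inter b' b
    rw [Finset.inter_comm, h4 b hb b' hb' h] at h2
    rw [h4 b hb b' hb' h] at h1
    rw [h8 _ hb] at h1
    rw [h8 _ hb'] at h2
    have h3 : (symmDiff b b').card = (b \ b').card + (b' \ b).card :=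
      Finset.card_union_of_disjoint disjoint_sdiff_sdiff
    omega

theorem center_add_mem {O : Finset (Fin 15)} (hO : IsCenter B O) :
    ∀ f ∈ blockCode B, blockFun O + f ∈ blockCode B := by
  intro f hf
  obtain ⟨b, hb, rfl⟩ := mem_blockCode.1 hf
  rw [← blockFun_symmDiff, blockFun_mem_blockCode]
  rcases hb with rfl | hb
  · rw [← Finset.bot_eq_empty, symmDiff_bot]
    exact Or.inr hO.1
  · by_cases h : b = O
    · subst h
      exact Or.inl (symmDiff_self b)
    · exact Or.inr (hO.2 b hb h)

theorem exists_coordinates (hD : IsDesign B) (hC2 : {O | IsCenter B O}.ncard = 3) :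
    ∃ e : Option (Fin 15) ≃ Plane × Plane, e none = 0 ∧
      ∀ f, f ∈ blockCode B ↔ ∃ u v, f = modelFun u v ∘ e := by
  have hempty := empty_notMem_of_isDesign hD
  obtain ⟨O₁, O₂, O₃, h12, -, -, hO⟩ := Set.ncard_eq_three.1 hC2
  have hO₁ : IsCenter B O₁ := (Set.ext_iff.1 hO O₁).2 (by simp)
  have hO₂ : IsCenter B O₂ := (Set.ext_iff.1 hO O₂).2 (by simp)
  have hne : ∀ b ∈ B, blockFun b ≠ 0 := fun b hb h => by
    rw [← blockFun_empty, blockFun_injective.eq_iff] at h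
    exact hempty (h ▸ hb)
  refine exists_model_form (by simp) ?_ ?_ none ?_ ?_ (hne _ hO₁.1) (hne _ hO₂.1)
    (blockFun_injective.ne h12) (center_add_mem hO₁) (center_add_mem hO₂) ?_
  · rw [blockCode, Finset.card_image_of_injective _ blockFun_injective,
      Finset.card_insert_of_notMem hempty, hD.1]
  · exact mem_blockCode.2 ⟨∅, Or.inl rfl, blockFun_empty⟩
  · intro f hf
    obtain ⟨b, -, rfl⟩ := mem_blockCode.1 hf
    rfl
  · intro f hf g hg hfg
    obtain ⟨b, hb, rfl⟩ := mem_blockCode.1 hf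
    obtain ⟨b', hb', rfl⟩ := mem_blockCode.1 hg
    have := sum_sgn_blockFun (symmDiff b b')
    rw [card_symmDiff_of_isDesign hD hb hb' fun h => hfg (h ▸ rfl), blockFun_symmDiff] at this
    simpa using this
  · intro hadd
    have : {O | IsCenter B O} = B := by
      ext O
      refine ⟨fun h => h.1, fun hOB => ⟨hOB, fun b hb hbO => ?_⟩⟩
      have := hadd _ (blockFun_mem_blockCode.2 (Or.inr hOB)) _
        (blockFun_mem_blockCode.2 (Or.inr hb))
      rw [← blockFun_symmDiff, blockFun_mem_blockCode] at this
      refine this.resolve_left fun h => hbO ?_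
      exact (symmDiff_eq_bot.1 h).symm
    rw [this, Set.ncard_coe_finset, hD.1] at hC2
    norm_num at hC2

theorem mem_designAut_iff (hD : IsDesign B) (σ : Equiv.Perm (Fin 15)) :
    σ ∈ designAut B ↔
      ∀ f, f ∘ σ.optionCongr ∈ blockCode B ↔ f ∈ blockCode B := by
  constructor
  · intro hσ f
    constructor
    · intro hf
      obtain ⟨b, hb, h⟩ := mem_blockCode.1 hf
      rw [← blockFun_image σ] at h
      rw [← σ.optionCongr.surjective.injective_comp_right h, blockFun_mem_blockCode]
      exact hb.imp (fun h => by simp [h]) (hσ b)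
    · intro hf
      obtain ⟨b, hb, rfl⟩ := mem_blockCode.1 hf
      have hb' : (b.image ⇑σ⁻¹).image ⇑σ = b := by simp [Finset.image_image]
      rw [← hb', blockFun_image, blockFun_mem_blockCode]
      exact hb.imp (fun h => by simp [h]) ((designAut B).inv_mem hσ b)
  · intro h b hb
    have h1 := (h (blockFun (b.image σ))).1 (by
      rw [blockFun_image]
      exact blockFun_mem_blockCode.2 (Or.inr hb))
    refine (blockFun_mem_blockCode.1 h1).resolve_left fun h2 => ?_
    rw [Finset.image_eq_empty] at h2
    exact empty_notMem_of_isDesign hD (h2 ▸ hb)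

/-- The action of permutations of the points on the coordinate space. -/
def coordHom (e : Option (Fin 15) ≃ Plane × Plane) :
    Equiv.Perm (Fin 15) →* Equiv.Perm (Plane × Plane) :=
  (Equiv.permCongrHom e).toMonoidHom.comp
    { toFun := fun σ => σ.optionCongr
      map_one' := by ext x; cases x <;> rfl
      map_mul' := fun σ ρ => by ext1 x; cases x <;> rfl }

theorem coordHom_comp (e : Option (Fin 15) ≃ Plane × Plane) (σ : Equiv.Perm (Fin 15)) :
    coordHom e σ ∘ e = e ∘ σ.optionCongr := by
  funext x
  simp [coordHom, Equiv.permCongrHom]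

theorem coordHom_injective (e : Option (Fin 15) ≃ Plane × Plane) :
    Function.Injective (coordHom e) :=
  (Equiv.permCongrHom e).injective.comp fun _ _ h => Equiv.optionCongr_injective h

theorem mem_designAut_iff_coordHom (hD : IsDesign B) {e : Option (Fin 15) ≃ Plane × Plane}
    (h0 : e none = 0) (he : ∀ f, f ∈ blockCode B ↔ ∃ u v, f = modelFun u v ∘ e)
    (σ : Equiv.Perm (Fin 15)) : σ ∈ designAut B ↔ coordHom e σ ∈ modelAut := by
  have hz : coordHom e σ 0 = 0 := by
    rw [← h0]
    exact congrFun (coordHom_comp e σ) none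
  have hcode : ∀ g : Plane × Plane → ZMod 2, g ∘ e ∈ blockCode B ↔ ∃ u v, g = modelFun u v :=
    fun g => by simp only [he, e.surjective.injective_comp_right.eq_iff]
  rw [mem_designAut_iff hD]
  change _ ↔ _ ∧ _
  rw [and_iff_right hz]
  constructor
  · intro h g
    rw [← hcode, ← hcode, ← h (g ∘ e), Function.comp_assoc, coordHom_comp, Function.comp_assoc]
  · intro h f
    have hf : (f ∘ e.symm) ∘ e = f := by funext; simp
    have := h (f ∘ e.symm)
    rw [← hcode, ← hcode, hf, Function.comp_assoc, coordHom_comp, ← Function.comp_assoc, hf]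
      at this
    exact this

theorem exists_optionCongr_eq {α : Type*} (τ : Equiv.Perm (Option α)) (h : τ none = none) :
    ∃ σ : Equiv.Perm α, σ.optionCongr = τ :=
  ⟨τ.removeNone, by
    ext1 x
    cases x with
    | none => simp [h]
    | some i =>
      refine τ.removeNone_some (Option.ne_none_iff_exists'.1 fun hi => ?_)
      exact Option.some_ne_none i (τ.injective (hi.trans h.symm))⟩

theorem nonempty_modelAut_mulEquiv (hD : IsDesign B) (hC2 : {O | IsCenter B O}.ncard = 3) :
    Nonempty (modelAut ≃* designAut B) := by
  obtain ⟨e, h0, he⟩ := exists_coordinates hD hC2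
  have hmem := mem_designAut_iff_coordHom hD h0 he
  let j : designAut B →* modelAut :=
    ((coordHom e).comp (designAut B).subtype).codRestrict modelAut
      fun σ => (hmem σ).1 σ.2
  refine ⟨(MulEquiv.ofBijective j ⟨fun σ ρ h => ?_, fun φ => ?_⟩).symm⟩
  · exact Subtype.ext (coordHom_injective e (congrArg Subtype.val h))
  · obtain ⟨σ, hσ⟩ := exists_optionCongr_eq ((Equiv.permCongrHom e).symm φ.1) (by
      change e.symm (φ.1 (e none)) = none
      rw [h0, φ.2.1, Equiv.symm_apply_eq, h0])
    have hσφ : coordHom e σ = φ := by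
      change Equiv.permCongrHom e σ.optionCongr = _
      rw [hσ, MulEquiv.apply_symm_apply]
    exact ⟨⟨σ, (hmem σ).2 (hσφ ▸ φ.2)⟩, Subtype.ext hσφ⟩

end Design

/-- for a design of type (C2) (exactly 3 center points), `Aut(𝒟)` is a
semidirect product of a normal subgroup `N ≅ C₂² ⋊ S₄` and a subgroup `H ≅ S₃`. -/
theorem stmt1 (B : Finset (Finset (Fin 15))) (hD : IsDesign B)
    (hC2 : {O | IsCenter B O}.ncard = 3) :
    ∃ N H : Subgroup ↥(designAut B),
      N.Normal ∧
      Nonempty (↥H ≃* Equiv.Perm (Fin 3)) ∧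
      N ⊓ H = ⊥ ∧
      (∀ g : ↥(designAut B), ∃ n ∈ N, ∃ h ∈ H, g = n * h) ∧
      ∃ N₀ K : Subgroup ↥(designAut B),
        N₀ ≤ N ∧ K ≤ N ∧
        (∀ g ∈ N, ∀ n ∈ N₀, g * n * g⁻¹ ∈ N₀) ∧
        Nonempty (↥N₀ ≃* Multiplicative (ZMod 2 × ZMod 2)) ∧
        Nonempty (↥K ≃* Equiv.Perm (Fin 4)) ∧
        N₀ ⊓ K = ⊥ ∧
        (∀ g ∈ N, ∃ n ∈ N₀, ∃ k ∈ K, g = n * k) := by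
  obtain ⟨ψ⟩ := Design.nonempty_modelAut_mulEquiv hD hC2
  exact Design.exists_decomposition_of_mulEquiv ψ
end

section
/- If 𝒟 is a symmetric (15,8,4)-design of type (C3), then Aut(𝒟) is a semidirect product: there exist a normal subgroup N of Aut(𝒟) isomorphic to (ZMod 2)³ and a subgroup H of Aut(𝒟) isomorphic to the alternating group A₄ on 4 letters, with N ∩ H trivial and N · H = Aut(𝒟). -/
/-- A line contained in the block family: a set of three blocks of the form
`{b₁, b₂, b₁ △ b₂}`. -/
def IsLineIn (B : Finset (Finset (Fin 15))) (l : Set (Finset (Fin 15))) : Prop :=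
  ∃ b₁ ∈ B, ∃ b₂ ∈ B, b₁ ≠ b₂ ∧ symmDiff b₁ b₂ ∈ B ∧
    l = {b₁, b₂, symmDiff b₁ b₂}

namespace C3Design

open Finset Equiv

/-- The point set whose image under `e` is the binary support of `m`. -/
def supp (e : Perm (Fin 15)) (m : ℕ) : Finset (Fin 15) :=
  univ.filter fun x => m.testBit (e x)

/-- The family of point sets encoded by a list of bit masks, in the labelling `e`. -/
def blocks (e : Perm (Fin 15)) (L : List ℕ) : Finset (Finset (Fin 15)) :=
  (L.map (supp e)).toFinset

lemma mem_supp {e : Perm (Fin 15)} {m : ℕ} {x : Fin 15} :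
    x ∈ supp e m ↔ m.testBit (e x) = true := by simp [supp]

lemma mem_blocks {e : Perm (Fin 15)} {L : List ℕ} {b : Finset (Fin 15)} :
    b ∈ blocks e L ↔ ∃ m ∈ L, supp e m = b := by simp [blocks]

/-- Bit masks of a design of type (C3). The points `0, …, 7` are the even subsets of `Fin 4`,
encoded by their intersection with `{0, 1, 2}`; the points `8, …, 14` are the nonempty ones. -/
def stdMasks : List ℕ :=
  [255, 21845, 21930, 26163, 26316, 30735, 30960, 19305, 19350, 11673, 11622, 7845, 7770, 13251,
    13116]

/-- Translation of the points `0, …, 7`, identified with `𝔽₂³`. -/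
def shiftFun (a : Multiplicative (ZMod 2 × ZMod 2 × ZMod 2)) (x : Fin 15) : Fin 15 :=
  if x.val < 8 then
    Fin.ofNat 15 (x.val ^^^
      (a.toAdd.1.val + 2 * a.toAdd.2.1.val + 4 * a.toAdd.2.2.val))
  else x

/-- Membership in the even subset of `Fin 4` encoded by `y`. -/
def evenBit (y : ℕ) (i : Fin 4) : Bool :=
  if i = 3 then (y.testBit 0 ^^ y.testBit 1 ^^ y.testBit 2) else y.testBit i

/-- The action of a permutation of `Fin 4` on the codes of even subsets. -/
def permuteEven (s : Perm (Fin 4)) (y : ℕ) : ℕ :=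
  (evenBit y (s⁻¹ 0)).toNat + 2 * (evenBit y (s⁻¹ 1)).toNat + 4 * (evenBit y (s⁻¹ 2)).toNat

/-- The action of a permutation of `Fin 4` on the points. -/
def permuteFun (s : Perm (Fin 4)) (x : Fin 15) : Fin 15 :=
  if x.val < 8 then Fin.ofNat 15 (permuteEven s x) else Fin.ofNat 15 (7 + permuteEven s (x - 7))

/-- The translations as a group of permutations of the points. -/
def shift : Multiplicative (ZMod 2 × ZMod 2 × ZMod 2) →* Perm (Fin 15) :=
  MonoidHom.toHomPerm
    { toFun := shiftFun
      map_one' := by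
        have h : ∀ x, shiftFun 1 x = x := by decide +kernel
        exact funext h
      map_mul' := by
        have h : ∀ a b x, shiftFun (a * b) x = shiftFun a (shiftFun b x) := by decide +kernel
        exact fun a b => funext (h a b) }

/-- The symmetric group on `Fin 4` as a group of permutations of the points. -/
def permute : Perm (Fin 4) →* Perm (Fin 15) :=
  MonoidHom.toHomPerm
    { toFun := permuteFun
      map_one' := by
        have h : ∀ x, permuteFun 1 x = x := by decide +kernel
        exact funext h
      map_mul' := by
        have h : ∀ a b x, permuteFun (a * b) x = permuteFun a (permuteFun b x) := by
          decide +kernel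
        exact fun a b => funext (h a b) }

lemma shift_apply (a x) : shift a x = shiftFun a x := rfl

lemma permute_apply (s x) : permute s x = permuteFun s x := rfl

lemma image_supp (e σ : Perm (Fin 15)) (m : ℕ) : (supp e m).image σ = supp (e * σ⁻¹) m := by
  ext x
  simp only [mem_image, mem_supp, Perm.coe_mul, Function.comp_apply]
  constructor
  · rintro ⟨y, hy, rfl⟩
    simpa using hy
  · exact fun h => ⟨σ⁻¹ x, h, by simp⟩

lemma supp_congr {e e' : Perm (Fin 15)} {m m' : ℕ}
    (h : ∀ x, m.testBit (e x) = m'.testBit (e' x)) : supp e m = supp e' m' := by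
  ext x
  rw [mem_supp, mem_supp, h]

lemma mem_designAut_blocks {σ : Perm (Fin 15)} {L : List ℕ}
    (h : ∀ m ∈ L, ∃ m' ∈ L, ∀ x : Fin 15, m.testBit x = m'.testBit (σ x)) :
    σ ∈ designAut (blocks 1 L) := by
  intro b hb
  obtain ⟨m, hm, rfl⟩ := mem_blocks.1 hb
  obtain ⟨m', hm', h'⟩ := h m hm
  refine mem_blocks.2 ⟨m', hm', ?_⟩
  rw [image_supp]
  refine (supp_congr fun x => ?_).symm
  simpa using h' (σ⁻¹ x)

lemma shift_mem (a) : shift a ∈ designAut (blocks 1 stdMasks) := by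
  refine mem_designAut_blocks ?_
  simp only [shift_apply]
  revert a
  decide +kernel

lemma permute_mem (s : alternatingGroup (Fin 4)) :
    permute s ∈ designAut (blocks 1 stdMasks) := by
  refine mem_designAut_blocks ?_
  simp only [permute_apply]
  obtain ⟨s, hs⟩ := s
  rw [Perm.mem_alternatingGroup] at hs
  have h : ∀ s : Perm (Fin 4), Perm.sign s = 1 → ∀ m ∈ stdMasks, ∃ m' ∈ stdMasks,
      ∀ x : Fin 15, m.testBit x = m'.testBit (permuteFun s x) := by
    decide +kernel
  exact h s hs

/-- The number of masks in `L` having the bits `x`, `y` and `z`. -/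
def tripleCount (L : List ℕ) (x y z : Fin 15) : ℕ :=
  L.countP fun m => m.testBit x && m.testBit y && m.testBit z

lemma card_filter_image {B : Finset (Finset (Fin 15))} {g : Perm (Fin 15)} (hg : g ∈ designAut B)
    (x y z : Fin 15) :
    (B.filter fun b => g x ∈ b ∧ g y ∈ b ∧ g z ∈ b).card =
      (B.filter fun b => x ∈ b ∧ y ∈ b ∧ z ∈ b).card := by
  have hg' : g⁻¹ ∈ designAut B := inv_mem hg
  symm
  refine card_nbij' (fun b => b.image g) (fun b => b.image (g⁻¹ : Perm (Fin 15))) ?_ ?_ ?_ ?_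
  · intro b hb
    simp only [coe_filter, Set.mem_ofPred_eq] at hb ⊢
    simpa using ⟨hg b hb.1, hb.2⟩
  · intro b hb
    simp only [coe_filter, Set.mem_ofPred_eq] at hb ⊢
    refine ⟨hg' b hb.1, ?_⟩
    simp only [mem_image]
    exact ⟨⟨_, hb.2.1, by simp⟩, ⟨_, hb.2.2.1, by simp⟩, ⟨_, hb.2.2.2, by simp⟩⟩
  · intro b _
    simp [image_image, Function.comp_def]
  · intro b _
    simp [image_image, Function.comp_def]

lemma tripleCount_eq_card {L : List ℕ} (hL : (L.map (supp 1)).Nodup) (x y z : Fin 15) :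
    tripleCount L x y z = ((blocks 1 L).filter fun b => x ∈ b ∧ y ∈ b ∧ z ∈ b).card := by
  have h : ((blocks 1 L).filter fun b => x ∈ b ∧ y ∈ b ∧ z ∈ b) =
      ((L.map (supp 1)).filter fun b => x ∈ b ∧ y ∈ b ∧ z ∈ b).toFinset := by
    rw [List.toFinset_filter, blocks]
    simp
  rw [h, List.toFinset_card_of_nodup (hL.filter _), ← List.countP_eq_length_filter,
    List.countP_map, tripleCount]
  congr 1
  funext m
  simp [mem_supp, Bool.and_assoc]

lemma nodup_stdMasks : (stdMasks.map (supp 1)).Nodup := by decide +kernel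

lemma tripleCount_image {g : Perm (Fin 15)} (hg : g ∈ designAut (blocks 1 stdMasks))
    (x y z : Fin 15) :
    tripleCount stdMasks (g x) (g y) (g z) = tripleCount stdMasks x y z := by
  rw [tripleCount_eq_card nodup_stdMasks, tripleCount_eq_card nodup_stdMasks,
    card_filter_image hg]

/-- The points `0, …, 7` are distinguished by the number of triples through them that lie in no
block. -/
lemma apply_zero_lt {g : Perm (Fin 15)} (hg : g ∈ designAut (blocks 1 stdMasks)) :
    (g 0).val < 8 := by
  have h : ∀ x : Fin 15,
      (univ.filter fun p : Fin 15 × Fin 15 => tripleCount stdMasks x p.1 p.2 = 0).card =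
        (univ.filter fun p : Fin 15 × Fin 15 => tripleCount stdMasks 0 p.1 p.2 = 0).card →
      x.val < 8 := by
    decide +kernel
  refine h _ (card_equiv (g.prodCongr g) fun p => ?_).symm
  simp [tripleCount_image hg]

/-- All partial maps, as lists of source-image pairs, that fix `0`, are defined on the given points
and preserve the number of masks containing a new point and two consecutive earlier ones. -/
def partialMaps : List (Fin 15) → List (List (Fin 15 × Fin 15))
  | [] => [[(0, 0)]]
  | z :: l => (partialMaps l).flatMap fun r =>
      ((List.finRange 15).filter fun y => (r.zip r.tail).all fun (p, q) =>
        tripleCount stdMasks p.2 q.2 y == tripleCount stdMasks p.1 q.1 z).map fun y => (z, y) :: r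

lemma map_mem_partialMaps {g : Perm (Fin 15)} (hg : g ∈ designAut (blocks 1 stdMasks))
    (h0 : g 0 = 0) (l : List (Fin 15)) :
    (l ++ [0]).map (fun z => (z, g z)) ∈ partialMaps l := by
  induction l with
  | nil => simp [partialMaps, h0]
  | cons z l ih =>
    simp only [partialMaps, List.mem_flatMap, List.cons_append, List.map_cons, List.mem_map,
      List.mem_filter]
    refine ⟨_, ih, g z, ⟨List.mem_finRange _, ?_⟩, rfl⟩
    simp only [List.all_eq_true, beq_iff_eq]
    rintro ⟨p, q⟩ hpq
    obtain ⟨hp, hq⟩ := List.of_mem_zip hpq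
    obtain ⟨x, -, rfl⟩ := List.mem_map.1 hp
    obtain ⟨y, -, rfl⟩ := List.mem_map.1 (List.mem_of_mem_tail hq)
    exact tripleCount_image hg x y z

/-- An ordering of the nonzero points for which `partialMaps` stays small. -/
def pointOrder : List (Fin 15) := [12, 2, 14, 5, 9, 4, 13, 11, 1, 3, 7, 10, 6, 8]

lemma partialMaps_pointOrder : ∀ r ∈ partialMaps pointOrder,
    ∃ s : Perm (Fin 4), (∀ p ∈ r, p.2 = permuteFun s p.1) ∧ Perm.sign s = 1 := by
  decide +kernel

lemma exists_eq_shift_mul_permute {g : Perm (Fin 15)}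
    (hg : g ∈ designAut (blocks 1 stdMasks)) :
    ∃ a, ∃ s : alternatingGroup (Fin 4), g = shift a * permute s := by
  have h : ∀ x : Fin 15, x.val < 8 → ∃ a, shiftFun a x = 0 := by decide +kernel
  obtain ⟨a, ha⟩ := h _ (apply_zero_lt hg)
  obtain ⟨s, h, hs⟩ := partialMaps_pointOrder _
    (map_mem_partialMaps (mul_mem (shift_mem a) hg) ha pointOrder)
  refine ⟨a⁻¹, ⟨s, Perm.mem_alternatingGroup.2 hs⟩, ?_⟩
  rw [map_inv, eq_inv_mul_iff_mul_eq]
  refine Equiv.ext fun x => ?_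
  have hx : x ∈ pointOrder ++ [0] := by revert x; decide
  exact h (x, (shift a * g) x) (List.mem_map.2 ⟨x, hx, rfl⟩)

lemma shift_injective : Function.Injective shift := by
  rw [injective_iff_map_eq_one]
  intro a h
  have h0 : shiftFun a 0 = 0 := by rw [← shift_apply, h]; rfl
  revert a
  decide +kernel

lemma permute_injective : Function.Injective permute := by
  rw [injective_iff_map_eq_one]
  intro s h
  have h0 : ∀ x, permuteFun s x = x := fun x => by rw [← permute_apply, h]; rfl
  clear h
  revert s
  decide +kernel

lemma permute_conj_shift (s : Perm (Fin 4)) (a) :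
    ∃ a', permute s * shift a = shift a' * permute s := by
  have h : ∀ (s : Perm (Fin 4)) a, ∃ a', ∀ x,
      permuteFun s (shiftFun a x) = shiftFun a' (permuteFun s x) := by
    decide +kernel
  obtain ⟨a', h'⟩ := h s a
  exact ⟨a', Equiv.ext h'⟩

lemma eq_one_of_shift_eq_permute {s : Perm (Fin 4)} {a} (h : shift a = permute s) : a = 1 := by
  have h0 : shiftFun a 0 = 0 := by
    rw [← shift_apply, h, permute_apply]
    clear h
    revert s
    decide +kernel
  clear h
  revert a
  decide +kernel

/-- The group `G` is a semidirect product of an elementary abelian normal subgroup of order `8` by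
an alternating group of degree `4`. -/
def IsSemidirect (G : Type*) [Group G] : Prop :=
  ∃ N H : Subgroup G, N.Normal ∧
    Nonempty (↥N ≃* Multiplicative (ZMod 2 × ZMod 2 × ZMod 2)) ∧
    Nonempty (↥H ≃* ↥(alternatingGroup (Fin 4))) ∧
    N ⊓ H = ⊥ ∧ ∀ g : G, ∃ n ∈ N, ∃ h ∈ H, g = n * h

lemma IsSemidirect.congr {G G' : Type*} [Group G] [Group G'] (φ : G ≃* G')
    (h : IsSemidirect G) : IsSemidirect G' := by
  obtain ⟨N, H, hN, ⟨eN⟩, ⟨eH⟩, hNH, hmul⟩ := h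
  refine ⟨N.map (φ : G →* G'), H.map (φ : G →* G'), hN.map _ φ.surjective,
    ⟨(φ.subgroupMap N).symm.trans eN⟩, ⟨(φ.subgroupMap H).symm.trans eH⟩, ?_, fun g => ?_⟩
  · rw [← Subgroup.map_inf _ _ _ φ.injective, hNH, Subgroup.map_bot]
  · obtain ⟨n, hn, h, hh, e⟩ := hmul (φ.symm g)
    exact ⟨φ n, Subgroup.mem_map_of_mem _ hn, φ h, Subgroup.mem_map_of_mem _ hh, by
      rw [← map_mul, ← e, φ.apply_symm_apply]⟩

lemma isSemidirect_std : IsSemidirect (designAut (blocks 1 stdMasks)) := by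
  let n := shift.codRestrict (designAut (blocks 1 stdMasks)) shift_mem
  let h := (permute.comp (alternatingGroup (Fin 4)).subtype).codRestrict
    (designAut (blocks 1 stdMasks)) permute_mem
  have hn : Function.Injective n := fun a b hab =>
    shift_injective (congrArg Subtype.val hab)
  have hh : Function.Injective h := fun a b hab =>
    Subtype.ext (permute_injective (congrArg Subtype.val hab))
  have hmul : ∀ g, ∃ a s, g = n a * h s := fun g => by
    obtain ⟨a, s, e⟩ := exists_eq_shift_mul_permute g.2
    exact ⟨a, s, Subtype.ext e⟩
  refine ⟨n.range, h.range, ⟨?_⟩, ⟨(MonoidHom.ofInjective hn).symm⟩,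
    ⟨(MonoidHom.ofInjective hh).symm⟩, ?_, fun g => ?_⟩
  · rintro _ ⟨a, rfl⟩ g
    obtain ⟨b, s, rfl⟩ := hmul g
    obtain ⟨a', ha'⟩ := permute_conj_shift s a
    have ha : h s * n a = n a' * h s := Subtype.ext ha'
    refine ⟨b * a' * b⁻¹, ?_⟩
    rw [mul_assoc (n b), ha]
    simp only [map_mul, map_inv]
    group
  · rw [eq_bot_iff]
    rintro _ ⟨⟨a, rfl⟩, s, hs⟩
    have := eq_one_of_shift_eq_permute (congrArg Subtype.val hs).symm
    simp [this]
  · obtain ⟨a, s, e⟩ := hmul g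
    exact ⟨n a, ⟨a, rfl⟩, h s, ⟨s, rfl⟩, e⟩

lemma designAut_blocks (e : Perm (Fin 15)) (L : List ℕ) :
    (designAut (blocks e L)).map (MulAut.conj e : Perm (Fin 15) →* Perm (Fin 15)) =
      designAut (blocks 1 L) := by
  have key : ∀ e' σ τ : Perm (Fin 15), σ ∈ designAut (blocks e' L) →
      τ * σ * τ⁻¹ ∈ designAut (blocks (e' * τ⁻¹) L) := by
    intro e' σ τ h b hb
    obtain ⟨m, hm, rfl⟩ := mem_blocks.1 hb
    obtain ⟨m', hm', h'⟩ := mem_blocks.1 (h _ (mem_blocks.2 ⟨m, hm, rfl⟩))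
    refine mem_blocks.2 ⟨m', hm', ?_⟩
    rw [← image_supp, h', image_supp, image_supp, image_supp]
    congr 1
    group
  ext σ
  constructor
  · rintro ⟨σ, hσ, rfl⟩
    simpa using key e σ e hσ
  · intro hσ
    exact ⟨e⁻¹ * σ * e, by simpa using key 1 σ e⁻¹ hσ, by simp [mul_assoc]⟩

lemma isSemidirect_blocks (e : Perm (Fin 15)) :
    IsSemidirect (designAut (blocks e stdMasks)) :=
  isSemidirect_std.congr (((MulAut.conj e).subgroupMap _).trans
    (MulEquiv.subgroupCongr (designAut_blocks e stdMasks))).symm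

/-- The number of ones among the `n` lowest binary digits. -/
def popcount : ℕ → ℕ → ℕ
  | 0, _ => 0
  | n + 1, m => popcount n m + (m.testBit n).toNat

lemma popcount_eq_sum (n m : ℕ) : popcount n m = ∑ i ∈ range n, (m.testBit i).toNat := by
  induction n with
  | zero => rfl
  | succ n ih => rw [popcount, ih, sum_range_succ]

lemma card_supp (e : Perm (Fin 15)) (m : ℕ) : (supp e m).card = popcount 15 m := by
  rw [popcount_eq_sum, ← Fin.sum_univ_eq_sum_range (fun i => (m.testBit i).toNat), supp, card_filter,
    ← Equiv.sum_comp e fun i : Fin 15 => (m.testBit i).toNat]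
  refine sum_congr rfl fun x _ => ?_
  cases m.testBit (e x) <;> rfl

lemma supp_inter (e : Perm (Fin 15)) (m m' : ℕ) : supp e m ∩ supp e m' = supp e (m &&& m') := by
  ext x
  simp [mem_supp]

lemma supp_symmDiff (e : Perm (Fin 15)) (m m' : ℕ) :
    symmDiff (supp e m) (supp e m') = supp e (m ^^^ m') := by
  ext x
  simp only [mem_symmDiff, mem_supp, Nat.testBit_xor]
  cases m.testBit (e x) <;> cases m'.testBit (e x) <;> simp

lemma supp_injOn (e : Perm (Fin 15)) {m m' : ℕ} (hm : m < 2 ^ 15) (hm' : m' < 2 ^ 15)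
    (h : supp e m = supp e m') : m = m' := by
  refine Nat.eq_of_testBit_eq fun i => ?_
  by_cases hi : i < 15
  · have := congrArg (e.symm ⟨i, hi⟩ ∈ ·) h
    simpa [mem_supp] using this
  · have h2 : (2 : ℕ) ^ 15 ≤ 2 ^ i := Nat.pow_le_pow_right (by norm_num) (by omega)
    rw [Nat.testBit_lt_two_pow (hm.trans_le h2), Nat.testBit_lt_two_pow (hm'.trans_le h2)]

lemma exists_mask (e : Perm (Fin 15)) (s : Finset (Fin 15)) : ∃ m < 2 ^ 15, supp e m = s := by
  refine ⟨Nat.ofBits fun i : Fin 15 => decide (e.symm i ∈ s), Nat.ofBits_lt_two_pow _, ?_⟩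
  ext x
  simp [mem_supp]

lemma eq_sum_testBit {n m : ℕ} (hm : m < 2 ^ n) :
    m = ∑ i ∈ range n, (m.testBit i).toNat * 2 ^ i := by
  have h : ∀ k, m % 2 ^ k = ∑ i ∈ range k, (m.testBit i).toNat * 2 ^ i := fun k => by
    induction k with
    | zero => simp [Nat.mod_one]
    | succ k ih => rw [sum_range_succ, ← ih, Nat.mod_pow_succ, Nat.toNat_testBit, mul_comm (2 ^ k)]
  rw [← h, Nat.mod_eq_of_lt hm]

lemma card_filter_bool {f : Fin 15 → Bool × Bool × Bool × Bool}
    (p : Bool × Bool × Bool × Bool → Bool) :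
    (univ.filter fun x => p (f x)).card =
      ∑ k, if p k then (univ.filter fun x => f x = k).card else 0 := by
  rw [card_eq_sum_card_fiberwise (f := f) (t := univ) (by simp)]
  refine sum_congr rfl fun k _ => ?_
  rw [filter_filter]
  split_ifs with h
  · congr 1
    ext x
    simp only [mem_filter, mem_univ, true_and, and_iff_right_iff_imp]
    rintro rfl
    exact h
  · rw [card_eq_zero, filter_eq_empty_iff]
    rintro x - ⟨hx, rfl⟩
    exact h hx

/-- Four subsets whose nonzero combinations behave like hyperplane complements determine
coordinates on the points. -/
lemma exists_coordinates {s₀ s₁ s₂ s₃ : Finset (Fin 15)}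
    (h0 : s₀.card = 8) (h1 : s₁.card = 8) (h2 : s₂.card = 8) (h3 : s₃.card = 8)
    (h01 : (s₀ ∩ s₁).card = 4) (h02 : (s₀ ∩ s₂).card = 4) (h12 : (s₁ ∩ s₂).card = 4)
    (h012 : (s₀ ∩ symmDiff s₁ s₂).card = 4)
    (h03 : (s₃ ∩ s₀).card = 4) (h13 : (s₃ ∩ s₁).card = 4) (h23 : (s₃ ∩ s₂).card = 4)
    (h013 : (s₃ ∩ symmDiff s₀ s₁).card = 4) (h023 : (s₃ ∩ symmDiff s₀ s₂).card = 4)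
    (h123 : (s₃ ∩ symmDiff s₁ s₂).card = 4)
    (h0123 : (s₃ ∩ symmDiff s₀ (symmDiff s₁ s₂)).card = 4) :
    ∃ e : Perm (Fin 15), supp e 21845 = s₀ ∧ supp e 26214 = s₁ ∧ supp e 30840 = s₂ ∧
      supp e 32640 = s₃ := by
  let f : Fin 15 → Bool × Bool × Bool × Bool := fun x =>
    (decide (x ∈ s₀), decide (x ∈ s₁), decide (x ∈ s₂), decide (x ∈ s₃))
  have key : ∀ (s : Finset (Fin 15)) (p : Bool × Bool × Bool × Bool → Bool),
      (∀ x, x ∈ s ↔ p (f x) = true) →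
      s.card = ∑ k, if p k then (univ.filter fun x => f x = k).card else 0 := fun s p h => by
    rw [← card_filter_bool]
    congr 1
    ext x
    simp [h]
  have hx : ∀ (s t : Finset (Fin 15)) x,
      x ∈ symmDiff s t ↔ (decide (x ∈ s) ^^ decide (x ∈ t)) = true := fun s t x => by
    by_cases hs : x ∈ s <;> by_cases ht : x ∈ t <;> simp [mem_symmDiff, hs, ht]
  have hu := key univ (fun _ => true) (by simp)
  rw [key s₀ (fun k => k.1) (by simp [f])] at h0
  rw [key s₁ (fun k => k.2.1) (by simp [f])] at h1
  rw [key s₂ (fun k => k.2.2.1) (by simp [f])] at h2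
  rw [key s₃ (fun k => k.2.2.2) (by simp [f])] at h3
  rw [key _ (fun k => k.1 && k.2.1) (by simp [f])] at h01
  rw [key _ (fun k => k.1 && k.2.2.1) (by simp [f])] at h02
  rw [key _ (fun k => k.2.1 && k.2.2.1) (by simp [f])] at h12
  rw [key _ (fun k => k.1 && (k.2.1 ^^ k.2.2.1)) (by simp [f, hx])] at h012
  rw [key _ (fun k => k.2.2.2 && k.1) (by simp [f])] at h03
  rw [key _ (fun k => k.2.2.2 && k.2.1) (by simp [f])] at h13
  rw [key _ (fun k => k.2.2.2 && k.2.2.1) (by simp [f])] at h23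
  rw [key _ (fun k => k.2.2.2 && (k.1 ^^ k.2.1)) (by simp [f, hx])] at h013
  rw [key _ (fun k => k.2.2.2 && (k.1 ^^ k.2.2.1)) (by simp [f, hx])] at h023
  rw [key _ (fun k => k.2.2.2 && (k.2.1 ^^ k.2.2.1)) (by simp [f, hx])] at h123
  rw [key _ (fun k => k.2.2.2 && (k.1 ^^ (k.2.1 ^^ k.2.2.1)))
    (fun x => by
      by_cases h0 : x ∈ s₀ <;> by_cases h1 : x ∈ s₁ <;> simp [f, hx, h0, h1])] at h0123
  clear key hx
  have hn : ∀ k, (univ.filter fun x => f x = k).card =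
      if k = (false, false, false, false) then 0 else 1 := by
    generalize hN : (fun k => (univ.filter fun x => f x = k).card) = N
    have hN' : ∀ k, (univ.filter fun x => f x = k).card = N k := fun k => by rw [← hN]
    simp only [hN'] at *
    clear hN hN'
    simp [Fintype.sum_prod_type] at *
    refine ⟨⟨⟨⟨?_, ?_⟩, ?_, ?_⟩, ⟨?_, ?_⟩, ?_, ?_⟩, ⟨⟨?_, ?_⟩, ?_, ?_⟩, ⟨?_, ?_⟩, ?_, ?_⟩ <;> omega
  have hf : Function.Injective f := fun x y hxy => by
    have hle : (univ.filter fun z => f z = f x).card ≤ 1 := by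
      rw [hn]
      split_ifs <;> simp
    exact card_le_one.1 hle x (by simp) y (by simp [hxy])
  have hf0 : ∀ x, f x ≠ (false, false, false, false) := fun x hx => by
    have := hn (false, false, false, false)
    rw [if_pos rfl, card_eq_zero, filter_eq_empty_iff] at this
    exact this (mem_univ x) hx
  let c : Bool × Bool × Bool × Bool → Fin 15 := fun k =>
    Fin.ofNat 15 (k.1.toNat + 2 * k.2.1.toNat + 4 * k.2.2.1.toNat + 8 * k.2.2.2.toNat - 1)
  have hc : ∀ k, k ≠ (false, false, false, false) → ∀ k', k' ≠ (false, false, false, false) →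
      c k = c k' → k = k' := by
    decide +kernel
  have hbits : ∀ k, k ≠ (false, false, false, false) →
      Nat.testBit 21845 (c k) = k.1 ∧ Nat.testBit 26214 (c k) = k.2.1 ∧
      Nat.testBit 30840 (c k) = k.2.2.1 ∧ Nat.testBit 32640 (c k) = k.2.2.2 := by
    decide +kernel
  have hinj : Function.Injective (c ∘ f) := fun x y h => hf (hc _ (hf0 x) _ (hf0 y) h)
  refine ⟨Equiv.ofBijective (c ∘ f) (Finite.injective_iff_bijective.1 hinj), ?_, ?_, ?_, ?_⟩ <;>
  · ext x
    rw [mem_supp]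
    simp only [Equiv.ofBijective_apply, Function.comp_apply]
    obtain ⟨e0, e1, e2, e3⟩ := hbits _ (hf0 x)
    simp [e0, e1, e2, e3, f]

/-- The mask with lowest seven digits `v` that has exactly one of the digits `i` and `i + 8` for
`i < 7`. -/
def transversal (v : ℕ) : ℕ := v + 128 + 256 * (127 - v)

lemma exists_eq_transversal {m : ℕ} (hm : m < 2 ^ 15) (h : popcount 15 m = 8)
    (h0 : popcount 15 (m &&& 21845) = 4) (h1 : popcount 15 (m &&& 26214) = 4)
    (h2 : popcount 15 (m &&& 30840) = 4) (h01 : popcount 15 (m &&& (21845 ^^^ 26214)) = 4)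
    (h02 : popcount 15 (m &&& (21845 ^^^ 30840)) = 4)
    (h12 : popcount 15 (m &&& (26214 ^^^ 30840)) = 4)
    (h012 : popcount 15 (m &&& (21845 ^^^ (26214 ^^^ 30840))) = 4) :
    ∃ v < 128, m = transversal v := by
  have hs := eq_sum_testBit hm
  have hb : ∀ i, (m.testBit i).toNat ≤ 1 := fun i => Bool.toNat_le _
  have key : ∀ w, popcount 15 (m &&& w) =
      ∑ i ∈ range 15, (m.testBit i).toNat * (w.testBit i).toNat := fun w => by
    rw [popcount_eq_sum]
    refine sum_congr rfl fun i _ => ?_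
    rw [Nat.testBit_and]
    cases m.testBit i <;> cases w.testBit i <;> rfl
  rw [popcount_eq_sum] at h
  rw [key] at h0 h1 h2 h01 h02 h12 h012
  clear key
  generalize hx : (fun i => (m.testBit i).toNat) = x at *
  have hx' : ∀ i, (m.testBit i).toNat = x i := fun i => by rw [← hx]
  simp only [hx'] at *
  clear hx hx'
  simp [sum_range_succ, Nat.testBit] at hs h h0 h1 h2 h01 h02 h12 h012
  have := hb 0; have := hb 1; have := hb 2; have := hb 3; have := hb 4; have := hb 5
  have := hb 6; have := hb 7; have := hb 8; have := hb 9; have := hb 10; have := hb 11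
  have := hb 12; have := hb 13; have := hb 14
  have e7 : x 7 = 1 := by omega
  have e0 : x 0 + x 8 = 1 := by omega
  have e1 : x 1 + x 9 = 1 := by omega
  have e2 : x 2 + x 10 = 1 := by omega
  have e3 : x 3 + x 11 = 1 := by omega
  have e4 : x 4 + x 12 = 1 := by omega
  have e5 : x 5 + x 13 = 1 := by omega
  have e6 : x 6 + x 14 = 1 := by omega
  clear h h0 h1 h2 h01 h02 h12 h012
  refine ⟨m % 128, Nat.mod_lt _ (by norm_num), ?_⟩
  rw [transversal]
  omega

/-- The masks meeting the nine blocks spanned by the coordinates in four points each. -/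
def candidates : List ℕ :=
  ((List.range 128).map transversal).filter fun m =>
    popcount 15 (m &&& 32640) == 4 && popcount 15 (m &&& (32640 ^^^ 21845)) == 4

/-- The masks of a design in coordinates, three of them being given. -/
def extend (m₁ m₂ m₃ : ℕ) : List ℕ :=
  [21845, 26214, 30840, 26214 ^^^ 30840, 21845 ^^^ 26214, 21845 ^^^ 30840,
    21845 ^^^ (26214 ^^^ 30840), 32640, 21845 ^^^ 32640, m₁, 21845 ^^^ m₁, m₂, 21845 ^^^ m₂,
    m₃, 21845 ^^^ m₃]

/-- The map from the coordinates to the labelling used for `stdMasks`, for one of the two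
completions of the coordinate blocks to a design of type (C3). -/
def relabel : Perm (Fin 15) where
  toFun := ![1, 13, 3, 9, 5, 11, 7, 14, 6, 8, 4, 12, 2, 10, 0]
  invFun := ![14, 0, 12, 2, 10, 4, 8, 6, 9, 3, 13, 5, 11, 1, 7]
  left_inv := by decide
  right_inv := by decide

/-- The map from the coordinates to the labelling used for `stdMasks`, for the other completion of
the coordinate blocks to a design of type (C3). -/
def relabel' : Perm (Fin 15) where
  toFun := ![5, 11, 3, 9, 1, 13, 7, 14, 2, 10, 4, 12, 6, 8, 0]
  invFun := ![14, 4, 8, 2, 10, 0, 12, 6, 13, 3, 9, 1, 11, 5, 7]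
  left_inv := by decide
  right_inv := by decide

lemma extend_classification : ∀ m₁ ∈ candidates, ∀ m₂ ∈ candidates,
    popcount 15 (m₁ &&& m₂) = 4 → popcount 15 ((21845 ^^^ m₁) &&& m₂) = 4 →
    ∀ m₃ ∈ candidates, popcount 15 (m₁ &&& m₃) = 4 → popcount 15 ((21845 ^^^ m₁) &&& m₃) = 4 →
    popcount 15 (m₂ &&& m₃) = 4 → popcount 15 ((21845 ^^^ m₂) &&& m₃) = 4 →
    (extend m₁ m₂ m₃).Nodup ∧ (∀ m ∈ extend m₁ m₂ m₃, m < 2 ^ 15) ∧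
      ((∃ z ∈ [26214, 30840, 26214 ^^^ 30840],
          ∀ m ∈ extend m₁ m₂ m₃, m ≠ z → z ^^^ m ∈ extend m₁ m₂ m₃) ∨
        ∃ τ ∈ [relabel, relabel'], ∀ m ∈ extend m₁ m₂ m₃, ∃ m' ∈ stdMasks,
          ∀ i : Fin 15, m.testBit i = m'.testBit (τ i)) := by
  decide +kernel

/-- The masks spanned by the coordinates that lie in the design. -/
def coreMasks : List ℕ :=
  [21845, 26214, 30840, 26214 ^^^ 30840, 21845 ^^^ 26214, 21845 ^^^ 30840,
    21845 ^^^ (26214 ^^^ 30840), 32640, 21845 ^^^ 32640]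

lemma exists_mem_notMem_list {α : Type*} [DecidableEq α] {B : Finset α} {L : List α}
    (h : L.length < B.card) : ∃ c ∈ B, c ∉ L := by
  obtain ⟨c, hc, hcL⟩ := exists_mem_notMem_of_card_lt_card ((List.toFinset_card_le L).trans_lt h)
  exact ⟨c, hc, by simpa using hcL⟩

lemma popcount_inter {B : Finset (Finset (Fin 15))} (hD : IsDesign B) {e : Perm (Fin 15)}
    {m m' : ℕ} (hm : supp e m ∈ B) (hm' : supp e m' ∈ B) (h : supp e m ≠ supp e m') :
    popcount 15 (m &&& m') = 4 := by
  rw [← card_supp e, ← supp_inter]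
  exact hD.2.2 _ hm _ hm' h

lemma exists_mem_candidates {B : Finset (Finset (Fin 15))} (hD : IsDesign B) {e : Perm (Fin 15)}
    (hcore : ∀ w ∈ coreMasks, supp e w ∈ B) {c : Finset (Fin 15)} (hc : c ∈ B)
    (hcW : c ∉ coreMasks.map (supp e)) : ∃ m ∈ candidates, supp e m = c := by
  obtain ⟨m, hm, rfl⟩ := exists_mask e c
  have key : ∀ w ∈ coreMasks, popcount 15 (m &&& w) = 4 := fun w hw =>
    popcount_inter hD hc (hcore w hw) fun h => hcW (List.mem_map.2 ⟨w, hw, h.symm⟩)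
  have h8 : popcount 15 m = 8 := by rw [← card_supp e, hD.2.1 _ hc]
  simp only [coreMasks, List.forall_mem_cons] at key
  obtain ⟨k0, k1, k2, k12, k01, k02, k012, k3, k03, -⟩ := key
  obtain ⟨v, hv, hmv⟩ := exists_eq_transversal hm h8 k0 k1 k2 k01 k02 k12 k012
  refine ⟨m, ?_, rfl⟩
  rw [Nat.xor_comm] at k03
  simp only [candidates, List.mem_filter, List.mem_map, List.mem_range]
  exact ⟨⟨v, hv, hmv.symm⟩, by rw [k3, k03]; rfl⟩

lemma exists_core {B : Finset (Finset (Fin 15))} (hD : IsDesign B) {O b₁ b₂ : Finset (Fin 15)}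
    (hO : IsCenter B O) (hb₁ : b₁ ∈ B) (hb₂ : b₂ ∈ B) (hne : b₁ ≠ b₂) (hb : symmDiff b₁ b₂ ∈ B)
    (h1 : b₁ ≠ O) (h2 : b₂ ≠ O) (h12 : symmDiff b₁ b₂ ≠ O) :
    ∃ e : Perm (Fin 15), supp e 21845 = O ∧ supp e 26214 = b₁ ∧ supp e 30840 = b₂ ∧
      ∀ w ∈ coreMasks, supp e w ∈ B := by
  have c1 := hO.2 _ hb₁ h1
  have c2 := hO.2 _ hb₂ h2
  have c12 := hO.2 _ hb h12
  obtain ⟨c, hc, hcW⟩ := exists_mem_notMem_list (B := B)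
    (L := [O, b₁, b₂, symmDiff b₁ b₂, symmDiff O b₁, symmDiff O b₂,
      symmDiff O (symmDiff b₁ b₂)]) (by simp [hD.1])
  simp only [List.mem_cons, List.not_mem_nil, or_false, not_or] at hcW
  obtain ⟨n0, n1, n2, n12, n01, n02, n012⟩ := hcW
  obtain ⟨e, rfl, rfl, rfl, rfl⟩ := exists_coordinates (hD.2.1 _ hO.1) (hD.2.1 _ hb₁)
    (hD.2.1 _ hb₂) (hD.2.1 _ hc) (hD.2.2 _ hO.1 _ hb₁ h1.symm) (hD.2.2 _ hO.1 _ hb₂ h2.symm)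
    (hD.2.2 _ hb₁ _ hb₂ hne) (hD.2.2 _ hO.1 _ hb h12.symm) (hD.2.2 _ hc _ hO.1 n0)
    (hD.2.2 _ hc _ hb₁ n1) (hD.2.2 _ hc _ hb₂ n2) (hD.2.2 _ hc _ c1 n01)
    (hD.2.2 _ hc _ c2 n02) (hD.2.2 _ hc _ hb n12) (hD.2.2 _ hc _ c12 n012)
  have c3 := hO.2 _ hc n0
  simp only [supp_symmDiff] at *
  refine ⟨e, rfl, rfl, rfl, ?_⟩
  simp only [coreMasks, List.forall_mem_cons]
  exact ⟨hO.1, hb₁, hb₂, hb, c1, c2, c12, hc, c3, by simp⟩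

lemma eq_blocks {B : Finset (Finset (Fin 15))} (hB : B.card = 15) {e : Perm (Fin 15)} {L : List ℕ}
    (hL : L.Nodup) (hlen : L.length = 15) (hlt : ∀ m ∈ L, m < 2 ^ 15)
    (h : ∀ m ∈ L, supp e m ∈ B) : B = blocks e L := by
  refine (eq_of_subset_of_card_le (fun b hb => ?_) ?_).symm
  · obtain ⟨m, hm, rfl⟩ := mem_blocks.1 hb
    exact h m hm
  · rw [blocks, List.toFinset_card_of_nodup, List.length_map, hlen, hB]
    exact hL.map_on fun x hx y hy hxy => supp_injOn e (hlt x hx) (hlt y hy) hxy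

theorem isSemidirect_designAut {B : Finset (Finset (Fin 15))} (hD : IsDesign B)
    {O b₁ b₂ : Finset (Fin 15)} (hO : IsCenter B O) (huniq : ∀ O', IsCenter B O' → O' = O)
    (hb₁ : b₁ ∈ B) (hb₂ : b₂ ∈ B) (hne : b₁ ≠ b₂) (hb : symmDiff b₁ b₂ ∈ B)
    (h1 : b₁ ≠ O) (h2 : b₂ ≠ O) (h12 : symmDiff b₁ b₂ ≠ O) : IsSemidirect (designAut B) := by
  obtain ⟨e, rfl, rfl, rfl, hcore⟩ := exists_core hD hO hb₁ hb₂ hne hb h1 h2 h12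
  have hcomp : ∀ L : List ℕ, 21845 ∈ L → ∀ m, supp e m ∈ B → supp e m ∉ L.map (supp e) →
      supp e (21845 ^^^ m) ∈ B := fun L hL m hm hmL => by
    rw [← supp_symmDiff]
    exact hO.2 _ hm fun h => hmL (List.mem_map.2 ⟨_, hL, h.symm⟩)
  have hpop : ∀ L : List ℕ, ∀ m m', m ∈ L → supp e m ∈ B → supp e m' ∈ B →
      supp e m' ∉ L.map (supp e) → popcount 15 (m &&& m') = 4 := fun L m m' hL hm hm' hmL =>
    popcount_inter hD hm hm' fun h => hmL (List.mem_map.2 ⟨m, hL, h⟩)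
  have hpick : ∀ L : List ℕ, coreMasks ⊆ L → L.length < 15 →
      ∃ m ∈ candidates, supp e m ∈ B ∧ supp e m ∉ L.map (supp e) := fun L hL hlen => by
    obtain ⟨c, hc, hcL⟩ := exists_mem_notMem_list (B := B) (L := L.map (supp e))
      (by rwa [List.length_map, hD.1])
    obtain ⟨m, hm, rfl⟩ := exists_mem_candidates hD hcore hc
      fun h => hcL (List.map_subset _ hL h)
    exact ⟨m, hm, hc, hcL⟩
  obtain ⟨m₁, hm₁, hB₁, hn₁⟩ := hpick coreMasks (by simp) (by decide)
  have hB₁' := hcomp _ (by decide) _ hB₁ hn₁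
  obtain ⟨m₂, hm₂, hB₂, hn₂⟩ := hpick (m₁ :: (21845 ^^^ m₁) :: coreMasks)
    (fun w hw => by simp [hw]) (by simp [coreMasks])
  have hB₂' := hcomp _ (by simp [coreMasks]) _ hB₂ hn₂
  obtain ⟨m₃, hm₃, hB₃, hn₃⟩ := hpick
    (m₂ :: (21845 ^^^ m₂) :: m₁ :: (21845 ^^^ m₁) :: coreMasks)
    (fun w hw => by simp [hw]) (by simp [coreMasks])
  have hB₃' := hcomp _ (by simp [coreMasks]) _ hB₃ hn₃
  obtain ⟨hnd, hlt, h⟩ := extend_classification m₁ hm₁ m₂ hm₂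
    (hpop _ _ _ (by simp) hB₁ hB₂ hn₂) (hpop _ _ _ (by simp) hB₁' hB₂ hn₂) m₃ hm₃
    (hpop _ _ _ (by simp) hB₁ hB₃ hn₃) (hpop _ _ _ (by simp) hB₁' hB₃ hn₃)
    (hpop _ _ _ (by simp) hB₂ hB₃ hn₃) (hpop _ _ _ (by simp) hB₂' hB₃ hn₃)
  have hmem : ∀ m ∈ extend m₁ m₂ m₃, supp e m ∈ B := by
    simp only [coreMasks, List.forall_mem_cons] at hcore
    obtain ⟨a0, a1, a2, a3, a4, a5, a6, a7, a8, a9⟩ := hcore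
    simp only [extend, List.forall_mem_cons]
    exact ⟨a0, a1, a2, a3, a4, a5, a6, a7, a8, hB₁, hB₁', hB₂, hB₂', hB₃, hB₃', a9⟩
  have hE : B = blocks e (extend m₁ m₂ m₃) := eq_blocks hD.1 hnd rfl hlt hmem
  obtain ⟨z, hz, hzc⟩ | ⟨τ, -, hτ⟩ := h
  · exfalso
    have hzE : z ∈ extend m₁ m₂ m₃ := by
      simp only [extend, List.mem_cons] at hz ⊢
      tauto
    have hcenter : IsCenter B (supp e z) := by
      refine ⟨hmem z hzE, fun b hbB hbz => ?_⟩
      rw [hE] at hbB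
      obtain ⟨m, hm, rfl⟩ := mem_blocks.1 hbB
      rw [supp_symmDiff]
      exact hmem _ (hzc m hm fun h => hbz (by rw [h]))
    have := supp_injOn e (hlt z hzE) (by norm_num) (huniq _ hcenter)
    subst this
    revert hz
    decide
  · have : B = blocks (τ * e) stdMasks := by
      refine eq_of_subset_of_card_le (fun b hbB => ?_) ?_
      · rw [hE] at hbB
        obtain ⟨m, hm, rfl⟩ := mem_blocks.1 hbB
        obtain ⟨m', hm', h⟩ := hτ m hm
        exact mem_blocks.2 ⟨m', hm', (supp_congr fun x => h (e x)).symm⟩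
      · rw [hD.1]
        exact (List.toFinset_card_le _).trans (by simp [stdMasks])
    rw [this]
    exact isSemidirect_blocks _

end C3Design

/-- for a design of type (C3), `Aut(𝒟)` is a semidirect product of a
normal subgroup isomorphic to `(ZMod 2)³` and a subgroup isomorphic to `A₄`. -/
theorem stmt2 (B : Finset (Finset (Fin 15))) (hD : IsDesign B)
    (hC3 : ∃ O, IsCenter B O ∧ (∀ O', IsCenter B O' → O' = O) ∧
      ∃ l, IsLineIn B l ∧ O ∉ l) :
    ∃ N H : Subgroup ↥(designAut B),
      N.Normal ∧
      Nonempty (↥N ≃* Multiplicative (ZMod 2 × ZMod 2 × ZMod 2)) ∧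
      Nonempty (↥H ≃* ↥(alternatingGroup (Fin 4))) ∧
      N ⊓ H = ⊥ ∧
      (∀ g : ↥(designAut B), ∃ n ∈ N, ∃ h ∈ H, g = n * h) := by
  obtain ⟨O, hO, huniq, _, ⟨b₁, hb₁, b₂, hb₂, hne, hb, rfl⟩, hOl⟩ := hC3
  simp only [Set.mem_insert_iff, Set.mem_singleton_iff, not_or] at hOl
  exact C3Design.isSemidirect_designAut hD hO huniq hb₁ hb₂ hne hb
    (Ne.symm hOl.1) (Ne.symm hOl.2.1) (Ne.symm hOl.2.2)
end

section
/- If 𝒟 is a symmetric (15,8,4)-design of type (C4), then Aut(𝒟) is a semidirect product: there exist a normal subgroup N of Aut(𝒟) isomorphic to (ZMod 2)³ and a subgroup H of Aut(𝒟) isomorphic to the Frobenius group C₇ ⋊ C₃ of order 21 (the unique nonabelian group of order 21), with N ∩ H trivial and N · H = Aut(𝒟). -/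
/-- Seven three-element lines in a seven-element point set, any two of which meet in one point. -/
structure IsFanoPlane {α : Type*} [DecidableEq α] (P : Finset α) (L : Fin 7 → Finset α) : Prop where
  card_points : P.card = 7
  subset : ∀ i, L i ⊆ P
  card_line : ∀ i, (L i).card = 3
  card_inter : ∀ i j, i ≠ j → (L i ∩ L j).card = 1

/-- The operation sending two distinct elements of a Steiner triple system to the third element
of their triple. -/
structure IsSteinerOp (f : Fin 7 → Fin 7 → Fin 7) : Prop where
  ne_left : ∀ i j, i ≠ j → f i j ≠ i
  comm : ∀ i j, i ≠ j → f i j = f j i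
  invol : ∀ i j, i ≠ j → f i (f i j) = j

namespace IsFanoPlane

variable {α : Type*} [DecidableEq α] {P : Finset α} {L : Fin 7 → Finset α}

theorem card_lines_through (h : IsFanoPlane P L) {p : α} (hp : p ∈ P) :
    (Finset.univ.filter fun i => p ∈ L i).card = 3 := by
  let c : α → Fin 7 → ℤ := fun p i => if p ∈ L i then 1 else 0
  have hcard : ∀ p, ((Finset.univ.filter fun i => p ∈ L i).card : ℤ) = ∑ i, c p i := by
    intro p; simp [c]
  have hsum : ∀ i j, ∑ p ∈ P, c p i * c p j = ((L i ∩ L j).card : ℤ) := by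
    intro i j
    have : L i ∩ L j = P.filter fun p => p ∈ L i ∧ p ∈ L j := by
      ext x
      simp only [Finset.mem_inter, Finset.mem_filter]
      exact ⟨fun hx => ⟨h.subset i hx.1, hx⟩, fun hx => hx.2⟩
    rw [this, Finset.card_filter]
    push_cast
    refine Finset.sum_congr rfl fun p _ => ?_
    by_cases h1 : p ∈ L i <;> by_cases h2 : p ∈ L j <;> simp [c, h1, h2]
  have hlin : ∑ p ∈ P, ∑ i, c p i = 21 := by
    rw [Finset.sum_comm]
    have : ∀ i, ∑ p ∈ P, c p i = 3 := by
      intro i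
      have h1 := hsum i i
      rw [Finset.inter_self, h.card_line] at h1
      rw [← Nat.cast_ofNat, ← h1]
      refine Finset.sum_congr rfl fun p _ => ?_
      by_cases h1 : p ∈ L i <;> simp [c, h1]
    simp [this]
  have hquad : ∑ p ∈ P, (∑ i, c p i) ^ 2 = 63 := by
    have : ∀ p, (∑ i, c p i) ^ 2 = ∑ i, ∑ j, c p i * c p j := by
      intro p; rw [sq, Finset.sum_mul_sum]
    simp only [this]
    rw [Finset.sum_comm]
    have : ∀ i, ∑ p ∈ P, ∑ j, c p i * c p j = 9 := by
      intro i
      rw [Finset.sum_comm]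
      have : ∀ j, ∑ p ∈ P, c p i * c p j = if i = j then 3 else 1 := by
        intro j
        rw [hsum]
        split_ifs with hij
        · subst hij; simp [h.card_line]
        · simp [h.card_inter i j hij]
      simp only [this]
      have hite : ∀ i : Fin 7, ∑ j, (if i = j then (3 : ℤ) else 1) = 9 := by decide
      exact hite i
    simp [this]
  have hzero : ∑ p ∈ P, (∑ i, c p i - 3) ^ 2 = 0 := by
    have : ∀ p, (∑ i, c p i - 3) ^ 2 = (∑ i, c p i) ^ 2 - 6 * (∑ i, c p i) + 9 := by
      intro p; ring
    simp only [this, Finset.sum_add_distrib, Finset.sum_sub_distrib, ← Finset.mul_sum, hlin, hquad]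
    simp [h.card_points]
  have := (Finset.sum_eq_zero_iff_of_nonneg fun p _ => sq_nonneg _).mp hzero p hp
  have h3 : ∑ i, c p i = 3 := by
    have := pow_eq_zero_iff (two_ne_zero) |>.mp this
    linarith
  exact_mod_cast (hcard p).trans h3

theorem exists_third (h : IsFanoPlane P L) {i j : Fin 7} (hij : i ≠ j) :
    ∃ k, k ≠ i ∧ k ≠ j ∧ ∀ p, p ∈ L i → p ∈ L j → ∀ m, p ∈ L m ↔ m = i ∨ m = j ∨ m = k := by
  obtain ⟨p, hp⟩ := Finset.card_eq_one.mp (h.card_inter i j hij)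
  have hpij : p ∈ L i ∩ L j := by simp [hp]
  rw [Finset.mem_inter] at hpij
  have h3 := h.card_lines_through (h.subset i hpij.1)
  have hsub : ({i, j} : Finset (Fin 7)) ⊆ Finset.univ.filter fun i => p ∈ L i := by
    intro m hm
    simp only [Finset.mem_insert, Finset.mem_singleton] at hm
    rcases hm with rfl | rfl <;> simp [hpij]
  have hdiff := Finset.card_sdiff_of_subset hsub
  rw [h3, Finset.card_pair hij] at hdiff
  obtain ⟨k, hk⟩ := Finset.card_eq_one.mp hdiff
  have hk' : ∀ m, (p ∈ L m ∧ ¬ (m = i ∨ m = j)) ↔ m = k := by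
    intro m
    have := congrArg (m ∈ ·) hk
    simpa using this
  have hkk := (hk' k).mpr rfl
  refine ⟨k, fun e => hkk.2 (Or.inl e), fun e => hkk.2 (Or.inr e), fun q hqi hqj m => ?_⟩
  have : q = p := by
    have : q ∈ L i ∩ L j := Finset.mem_inter.mpr ⟨hqi, hqj⟩
    simpa [hp] using this
  subst this
  have := hk' m
  constructor
  · intro hm; tauto
  · rintro (rfl | rfl | rfl)
    exacts [hqi, hqj, hkk.1]

theorem exists_common (h : IsFanoPlane P L) {i j : Fin 7} (hij : i ≠ j) :
    ∃ p, p ∈ L i ∧ p ∈ L j := by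
  obtain ⟨p, hp⟩ := Finset.card_eq_one.mp (h.card_inter i j hij)
  have hpij : p ∈ L i ∩ L j := by simp [hp]
  exact ⟨p, Finset.mem_inter.mp hpij⟩

theorem eq_of_mem (h : IsFanoPlane P L) {i j : Fin 7} (hij : i ≠ j) {p q : α}
    (hpi : p ∈ L i) (hpj : p ∈ L j) (hqi : q ∈ L i) (hqj : q ∈ L j) : p = q :=
  Finset.card_le_one.mp (h.card_inter i j hij).le p (Finset.mem_inter.mpr ⟨hpi, hpj⟩) q
    (Finset.mem_inter.mpr ⟨hqi, hqj⟩)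

theorem exists_lines (h : IsFanoPlane P L) {p : α} (hp : p ∈ P) :
    ∃ i j, i ≠ j ∧ p ∈ L i ∧ p ∈ L j := by
  have h3 := h.card_lines_through hp
  obtain ⟨i, hi, j, hj, hij⟩ := Finset.one_lt_card.mp (by omega :
    1 < (Finset.univ.filter fun i => p ∈ L i).card)
  simp only [Finset.mem_filter, Finset.mem_univ, true_and] at hi hj
  exact ⟨i, j, hij, hi, hj⟩

/-- Points of a Fano plane are separated by lines. -/
theorem eq_of_mem_iff (h : IsFanoPlane P L) {p q : α} (hp : p ∈ P)
    (hpq : ∀ i, p ∈ L i ↔ q ∈ L i) : p = q := by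
  obtain ⟨i, j, hij, hi, hj⟩ := h.exists_lines hp
  exact h.eq_of_mem hij hi hj ((hpq i).mp hi) ((hpq j).mp hj)

theorem exists_steinerOp (h : IsFanoPlane P L) :
    ∃ f, IsSteinerOp f ∧ ∀ i j, i ≠ j → ∀ p, p ∈ L i → p ∈ L j →
      ∀ m, p ∈ L m ↔ m = i ∨ m = j ∨ m = f i j := by
  have key : ∀ i j, ∃ k, i ≠ j → k ≠ i ∧ k ≠ j ∧
      ∀ p, p ∈ L i → p ∈ L j → ∀ m, p ∈ L m ↔ m = i ∨ m = j ∨ m = k := by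
    intro i j
    by_cases hij : i = j
    · exact ⟨i, fun hne => absurd hij hne⟩
    · obtain ⟨k, hk⟩ := h.exists_third hij
      exact ⟨k, fun _ => hk⟩
  choose f hf using key
  refine ⟨f, ⟨fun i j hij => (hf i j hij).1, fun i j hij => ?_, fun i j hij => ?_⟩,
    fun i j hij => (hf i j hij).2.2⟩
  · obtain ⟨p, hi, hj⟩ := h.exists_common hij
    have h1 := (hf i j hij).2.2 p hi hj (f i j)
    have h2 := (hf j i hij.symm).2.2 p hj hi (f i j)
    have h3 := (hf i j hij)
    tauto
  · obtain ⟨p, hi, hj⟩ := h.exists_common hij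
    obtain ⟨hki, hkj, hk⟩ := hf i j hij
    have hpk : p ∈ L (f i j) := (hk p hi hj _).mpr (by simp)
    have h2 := (hf i (f i j) hki.symm).2.2 p hi hpk j
    have h3 := hij.symm
    have h4 := hkj.symm
    tauto

/-- Three concurrent lines cover all points, and only their common point is covered twice. -/
theorem covered_by_concurrent (h : IsFanoPlane P L) {i j k : Fin 7} (hij : i ≠ j) (hik : i ≠ k)
    (hjk : j ≠ k) {p : α} (hi : p ∈ L i) (hj : p ∈ L j) (hk : p ∈ L k) {x : α} (hx : x ∈ P) :
    (x ∈ L i ↔ x ∈ L j) ↔ x ∈ L k := by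
  have hunion : L i ∪ L j ∪ L k = P := by
    refine Finset.eq_of_subset_of_card_le
      (Finset.union_subset (Finset.union_subset (h.subset i) (h.subset j)) (h.subset k)) ?_
    have h1 := Finset.card_union_add_card_inter (L i) (L j)
    have h2 := Finset.card_union_add_card_inter (L i ∪ L j) (L k)
    have h3 : (L i ∪ L j) ∩ L k ⊆ {p} := by
      intro y hy
      simp only [Finset.mem_inter, Finset.mem_union] at hy
      rw [Finset.mem_singleton]
      rcases hy with ⟨hy | hy, hyk⟩
      · exact h.eq_of_mem hik hy hyk hi hk
      · exact h.eq_of_mem hjk hy hyk hj hk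
    have h4 := Finset.card_le_card h3
    rw [Finset.card_singleton] at h4
    rw [h.card_inter i j hij, h.card_line, h.card_line] at h1
    rw [h.card_line] at h2
    rw [h.card_points]
    omega
  rw [← hunion] at hx
  simp only [Finset.mem_union] at hx
  have e1 : x ∈ L i → x ∈ L j → x = p := fun a b => h.eq_of_mem hij a b hi hj
  have e2 : x ∈ L i → x ∈ L k → x = p := fun a b => h.eq_of_mem hik a b hi hk
  have e3 : x ∈ L j → x ∈ L k → x = p := fun a b => h.eq_of_mem hjk a b hj hk
  by_cases hxp : x = p
  · subst hxp; tauto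
  · tauto

end IsFanoPlane

/-- The third point of the line through `i` and `j` in the cyclic Fano plane developed from
`{0, 1, 5}` modulo `7`. -/
def cyclicThird (i j : Fin 7) : Fin 7 := i + ![0, 5, 3, 2, 6, 1, 4] (j - i)

/-- The third point of the line through `i` and `j` in the cyclic Fano plane developed from
`{0, 1, 3}` modulo `7`. -/
def cyclicThird' (i j : Fin 7) : Fin 7 := i - ![0, 5, 3, 2, 6, 1, 4] (i - j)

namespace IsSteinerOp

variable {f g : Fin 7 → Fin 7 → Fin 7}

theorem ne_right (hf : IsSteinerOp f) {i j : Fin 7} (hij : i ≠ j) : f i j ≠ j := by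
  rw [hf.comm i j hij]; exact hf.ne_left j i hij.symm

theorem frame_injective (hf : IsSteinerOp f) {a b d : Fin 7} (hab : a ≠ b) (hda : d ≠ a)
    (hdb : d ≠ b) (hd : d ≠ f a b) :
    Function.Injective ![b, f a d, d, f b d, f a b, f (f a b) d, a] := by
  have h1 := hf.ne_left
  have h2 := hf.comm
  have h3 := hf.invol
  have h4 := fun i j (h : i ≠ j) => hf.ne_right h
  have n1 : a ≠ f b d := by grind
  have n2 : a ≠ f (f a b) d := by grind
  have n3 : b ≠ f a d := by grind
  have n4 : b ≠ f (f a b) d := by grind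
  have n5 : f a b ≠ f a d := by grind
  have n6 : f a b ≠ f b d := by grind
  have n7 : f a d ≠ f b d := by grind
  have n8 : f a d ≠ f (f a b) d := by grind
  have n9 : f b d ≠ f (f a b) d := by grind
  have n10 := h1 a b hab
  have n11 := h4 a b hab
  have n12 := h1 a d hda.symm
  have n13 := h4 a d hda.symm
  have n14 := h1 b d hdb.symm
  have n15 := h4 b d hdb.symm
  have n16 := h1 (f a b) d hd.symm
  have n17 := h4 (f a b) d hd.symm
  rw [← List.nodup_ofFn]
  simp [List.ofFn_succ, *, eq_comm]
  grind

theorem triple (hf : IsSteinerOp f) {x y z : Fin 7} (hxy : x ≠ y) (h : f x y = z) :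
    f x y = z ∧ f y x = z ∧ f x z = y ∧ f z x = y ∧ f y z = x ∧ f z y = x := by
  have h1 := hf.ne_left
  have h2 := hf.comm
  have h3 := hf.invol
  grind

/-- The Pasch configurations of a Fano plane, for the frame `a, b, d`. -/
theorem frame_relations (hf : IsSteinerOp f) {a b d : Fin 7} (hab : a ≠ b) (hda : d ≠ a)
    (hdb : d ≠ b) (hd : d ≠ f a b) :
    f a (f b d) = f (f a b) d ∧ f b (f a d) = f (f a b) d ∧ f (f a b) (f a d) = f b d := by
  have hinj := hf.frame_injective hab hda hdb hd
  have hsurj := Finite.surjective_of_injective hinj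
  obtain ⟨c, hc⟩ : ∃ c, c = f a b := ⟨_, rfl⟩
  obtain ⟨e, he⟩ : ∃ e, e = f a d := ⟨_, rfl⟩
  obtain ⟨h, hh⟩ : ∃ h, h = f b d := ⟨_, rfl⟩
  obtain ⟨l, hl⟩ : ∃ l, l = f c d := ⟨_, rfl⟩
  rw [← hc, ← he, ← hh, ← hl] at hinj hsurj ⊢
  have hnodup := List.nodup_ofFn.mpr hinj
  have hcov : ∀ x, x = b ∨ x = e ∨ x = d ∨ x = h ∨ x = c ∨ x = l ∨ x = a := by
    intro x
    obtain ⟨i, rfl⟩ := hsurj x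
    fin_cases i <;> simp
  simp [List.ofFn_succ] at hnodup
  obtain ⟨⟨hbe, hbd, hbh, hbc, hbl, hba⟩, ⟨hed, heh, hec, hel, hea⟩, ⟨hdh, hdc, hdl, hda⟩,
    ⟨hhc, hhl, hha⟩, ⟨hcl, hca⟩, hla⟩ := hnodup
  have F1 := hf.triple (Ne.symm hba) hc.symm
  have F2 := hf.triple (Ne.symm hda) he.symm
  have F3 := hf.triple hbd hh.symm
  have F4 := hf.triple (Ne.symm hdc) hl.symm
  clear hc he hh hl hd
  have F5 : f a h = l := by
    rcases hcov (f a h) with H | H | H | H | H | H | H <;>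
      have T := hf.triple (Ne.symm hha) H <;> have T1 := hf.ne_left a h (Ne.symm hha) <;>
      have T2 := hf.ne_right (Ne.symm hha) <;>
      clear hcov hinj hsurj <;> grind
  replace F5 := hf.triple (Ne.symm hha) F5
  have F6 : f b e = l := by
    rcases hcov (f b e) with H | H | H | H | H | H | H <;>
      have T := hf.triple hbe H <;> have T1 := hf.ne_left b e hbe <;>
      have T2 := hf.ne_right hbe <;>
      clear hcov hinj hsurj <;> grind
  replace F6 := hf.triple hbe F6
  have F7 : f c e = h := by
    rcases hcov (f c e) with H | H | H | H | H | H | H <;>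
      have T := hf.triple (Ne.symm hec) H <;> have T1 := hf.ne_left c e (Ne.symm hec) <;>
      have T2 := hf.ne_right (Ne.symm hec) <;>
      clear hcov hinj hsurj <;> grind
  replace F7 := hf.triple (Ne.symm hec) F7
  exact ⟨F5.1, F6.1, F7.1⟩

/-- A suitable frame identifies `f` and `g` with the two cyclic Steiner operations. -/
theorem exists_labelling_of_frame (hf : IsSteinerOp f) (hg : IsSteinerOp g)
    (hfg : ∀ i j, i ≠ j → f i j ≠ g i j) {a b : Fin 7} (hab : a ≠ b)
    (hframe : g a (f a b) = f b (g a b)) :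
    ∃ s : Fin 7 ≃ Fin 7, ∀ i j, i ≠ j →
      s (cyclicThird i j) = f (s i) (s j) ∧ s (cyclicThird' i j) = g (s i) (s j) := by
  obtain ⟨d, hd⟩ : ∃ d, d = g a b := ⟨_, rfl⟩
  have hda : d ≠ a := hd ▸ hg.ne_left a b hab
  have hdb : d ≠ b := hd ▸ hg.ne_right hab
  have hdf : d ≠ f a b := hd ▸ (hfg a b hab).symm
  have hinj := hf.frame_injective hab hda hdb hdf
  have hsurj := Finite.surjective_of_injective hinj
  obtain ⟨c, hc⟩ : ∃ c, c = f a b := ⟨_, rfl⟩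
  obtain ⟨e, he⟩ : ∃ e, e = f a d := ⟨_, rfl⟩
  obtain ⟨h, hh⟩ : ∃ h, h = f b d := ⟨_, rfl⟩
  obtain ⟨l, hl⟩ : ∃ l, l = f c d := ⟨_, rfl⟩
  obtain ⟨F5, F6, F7⟩ := hf.frame_relations hab hda hdb hdf
  rw [← hc, ← he, ← hh, ← hl] at hinj hsurj
  rw [← hc, ← hh, ← hl] at F5
  rw [← hc, ← he, ← hl] at F6
  rw [← hc, ← he, ← hh] at F7
  rw [← hc, ← hd, ← hh] at hframe
  have hnodup := List.nodup_ofFn.mpr hinj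
  have hcov : ∀ x, x = b ∨ x = e ∨ x = d ∨ x = h ∨ x = c ∨ x = l ∨ x = a := by
    intro x
    obtain ⟨i, rfl⟩ := hsurj x
    fin_cases i <;> simp
  simp [List.ofFn_succ] at hnodup
  obtain ⟨⟨hbe, hbd, hbh, hbc, hbl, hba⟩, ⟨hed, heh, hec, hel, hea⟩, ⟨hdh, hdc, hdl, hda⟩,
    ⟨hhc, hhl, hha⟩, ⟨hcl, hca⟩, hla⟩ := hnodup
  have F1 := hf.triple (Ne.symm hba) hc.symm
  have F2 := hf.triple (Ne.symm hda) he.symm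
  have F3 := hf.triple hbd hh.symm
  have F4 := hf.triple (Ne.symm hdc) hl.symm
  replace F5 := hf.triple (Ne.symm hha) F5
  replace F6 := hf.triple hbe F6
  replace F7 := hf.triple (Ne.symm hec) F7
  clear hc he hh hl
  have G1 := hg.triple (Ne.symm hba) hd.symm
  have G2 := hg.triple (Ne.symm hca) hframe
  have G3 : g a e = l := by
    rcases hcov (g a e) with H | H | H | H | H | H | H <;>
      have T := hg.triple (Ne.symm hea) H <;> have T1 := hg.ne_left a e (Ne.symm hea) <;>
      have T2 := hg.ne_right (Ne.symm hea) <;> have T3 := hfg a e (Ne.symm hea) <;>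
      clear hfg hcov hinj hsurj <;> grind
  replace G3 := hg.triple (Ne.symm hea) G3
  have G4 : g c d = e := by
    rcases hcov (g c d) with H | H | H | H | H | H | H <;>
      have T := hg.triple (Ne.symm hdc) H <;> have T1 := hg.ne_left c d (Ne.symm hdc) <;>
      have T2 := hg.ne_right (Ne.symm hdc) <;> have T3 := hfg c d (Ne.symm hdc) <;>
      clear hfg hcov hinj hsurj <;> grind
  replace G4 := hg.triple (Ne.symm hdc) G4
  have G5 : g b c = l := by
    rcases hcov (g b c) with H | H | H | H | H | H | H <;>
      have T := hg.triple hbc H <;> have T1 := hg.ne_left b c hbc <;>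
      have T2 := hg.ne_right hbc <;> have T3 := hfg b c hbc <;>
      clear hfg hcov hinj hsurj <;> grind
  replace G5 := hg.triple hbc G5
  have G6 : g b e = h := by
    rcases hcov (g b e) with H | H | H | H | H | H | H <;>
      have T := hg.triple hbe H <;> have T1 := hg.ne_left b e hbe <;>
      have T2 := hg.ne_right hbe <;> have T3 := hfg b e hbe <;>
      clear hfg hcov hinj hsurj <;> grind
  replace G6 := hg.triple hbe G6
  have G7 : g d h = l := by
    rcases hcov (g d h) with H | H | H | H | H | H | H <;>
      have T := hg.triple hdh H <;> have T1 := hg.ne_left d h hdh <;>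
      have T2 := hg.ne_right hdh <;> have T3 := hfg d h hdh <;>
      clear hfg hcov hinj hsurj <;> grind
  replace G7 := hg.triple hdh G7
  have hbij : Function.Bijective ![b, e, d, h, c, l, a] := ⟨hinj, hsurj⟩
  have key : ∀ i j : Fin 7, i ≠ j →
      ![b, e, d, h, c, l, a] (cyclicThird i j) =
        f (![b, e, d, h, c, l, a] i) (![b, e, d, h, c, l, a] j) ∧
      ![b, e, d, h, c, l, a] (cyclicThird' i j) =
        g (![b, e, d, h, c, l, a] i) (![b, e, d, h, c, l, a] j) := by
    intro i j hij
    clear * - hij F1 F2 F3 F4 F5 F6 F7 G1 G2 G3 G4 G5 G6 G7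
    fin_cases i <;> fin_cases j <;> first
      | exact absurd rfl hij
      | simp [cyclicThird, cyclicThird', F1, F2, F3, F4, F5, F6, F7, G1, G2, G3, G4, G5, G6, G7]
  exact ⟨Equiv.ofBijective _ hbij, fun i j hij => by
    simpa only [Equiv.ofBijective_apply] using key i j hij⟩

theorem frame_or_swap (hf : IsSteinerOp f) (hg : IsSteinerOp g)
    (hfg : ∀ i j, i ≠ j → f i j ≠ g i j) {a b : Fin 7} (hab : a ≠ b) :
    g a (f a b) = f b (g a b) ∨ g b (f b a) = f a (g b a) := by
  obtain ⟨d, hd⟩ : ∃ d, d = g a b := ⟨_, rfl⟩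
  have hda : d ≠ a := hd ▸ hg.ne_left a b hab
  have hdb : d ≠ b := hd ▸ hg.ne_right hab
  have hdf : d ≠ f a b := hd ▸ (hfg a b hab).symm
  have hinj := hf.frame_injective hab hda hdb hdf
  have hsurj := Finite.surjective_of_injective hinj
  obtain ⟨c, hc⟩ : ∃ c, c = f a b := ⟨_, rfl⟩
  obtain ⟨e, he⟩ : ∃ e, e = f a d := ⟨_, rfl⟩
  obtain ⟨h, hh⟩ : ∃ h, h = f b d := ⟨_, rfl⟩
  obtain ⟨l, hl⟩ : ∃ l, l = f c d := ⟨_, rfl⟩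
  obtain ⟨F5, F6, F7⟩ := hf.frame_relations hab hda hdb hdf
  rw [← hc, ← he, ← hh, ← hl] at hinj hsurj
  rw [← hc, ← hh, ← hl] at F5
  rw [← hc, ← he, ← hl] at F6
  rw [← hc, ← he, ← hh] at F7
  rw [← hf.comm a b hab, ← hg.comm a b hab, ← hc, ← hd, ← hh, ← he]
  have hnodup := List.nodup_ofFn.mpr hinj
  have hcov : ∀ x, x = b ∨ x = e ∨ x = d ∨ x = h ∨ x = c ∨ x = l ∨ x = a := by
    intro x
    obtain ⟨i, rfl⟩ := hsurj x
    fin_cases i <;> simp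
  simp [List.ofFn_succ] at hnodup
  obtain ⟨⟨hbe, hbd, hbh, hbc, hbl, hba⟩, ⟨hed, heh, hec, hel, hea⟩, ⟨hdh, hdc, hdl, hda⟩,
    ⟨hhc, hhl, hha⟩, ⟨hcl, hca⟩, hla⟩ := hnodup
  have F1 := hf.triple (Ne.symm hba) hc.symm
  have F2 := hf.triple (Ne.symm hda) he.symm
  have F3 := hf.triple hbd hh.symm
  have F4 := hf.triple (Ne.symm hdc) hl.symm
  replace F5 := hf.triple (Ne.symm hha) F5
  replace F6 := hf.triple hbe F6
  replace F7 := hf.triple (Ne.symm hec) F7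
  clear hc he hh hl
  have G1 := hg.triple (Ne.symm hba) hd.symm
  clear hd
  by_contra! hne
  have A : g a c ≠ e := by
    intro hA
    have hA' := hg.triple (Ne.symm hca) hA
    rcases hcov (g a h) with H | H | H | H | H | H | H <;>
      have T := hg.triple (Ne.symm hha) H <;> have T1 := hg.ne_left a h (Ne.symm hha) <;>
      have T2 := hg.ne_right (Ne.symm hha) <;> have T3 := hfg a h (Ne.symm hha) <;>
      clear hfg hcov hinj hsurj <;> grind
  have B : g b c ≠ h := by
    intro hB
    have hB' := hg.triple hbc hB
    rcases hcov (g b e) with H | H | H | H | H | H | H <;>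
      have T := hg.triple hbe H <;> have T1 := hg.ne_left b e hbe <;>
      have T2 := hg.ne_right hbe <;> have T3 := hfg b e hbe <;>
      clear hfg hcov hinj hsurj <;> grind
  have A' : g a c = l := by
    rcases hcov (g a c) with H | H | H | H | H | H | H <;>
      have T := hg.triple (Ne.symm hca) H <;> have T1 := hg.ne_left a c (Ne.symm hca) <;>
      have T2 := hg.ne_right (Ne.symm hca) <;> have T3 := hfg a c (Ne.symm hca) <;>
      clear hfg hcov hinj hsurj <;> grind
  have A'' := hg.triple (Ne.symm hca) A'
  rcases hcov (g b c) with H | H | H | H | H | H | H <;>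
    have T := hg.triple hbc H <;> have T1 := hg.ne_left b c hbc <;>
    have T2 := hg.ne_right hbc <;> have T3 := hfg b c hbc <;>
    clear hfg hcov hinj hsurj <;> grind

/-- Any two disjoint Steiner triple systems on seven points are simultaneously isomorphic to
the two cyclic ones. -/
theorem exists_labelling (hf : IsSteinerOp f) (hg : IsSteinerOp g)
    (hfg : ∀ i j, i ≠ j → f i j ≠ g i j) :
    ∃ s : Fin 7 ≃ Fin 7, ∀ i j, i ≠ j →
      s (cyclicThird i j) = f (s i) (s j) ∧ s (cyclicThird' i j) = g (s i) (s j) := by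
  have h01 : (0 : Fin 7) ≠ 1 := by decide
  rcases hf.frame_or_swap hg hfg h01 with h | h
  · exact hf.exists_labelling_of_frame hg hfg h01 h
  · exact hf.exists_labelling_of_frame hg hfg h01.symm h

end IsSteinerOp

/-- The group `G` is a semidirect product of a normal elementary abelian subgroup of order `8` and
a nonabelian subgroup of order `21`. -/
def IsFrobeniusSplit (G : Type*) [Group G] : Prop :=
  ∃ N H : Subgroup G, N.Normal ∧
    Nonempty (↥N ≃* Multiplicative (ZMod 2 × ZMod 2 × ZMod 2)) ∧
    (Nat.card ↥H = 21 ∧ ¬ (∀ a b : ↥H, a * b = b * a)) ∧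
    N ⊓ H = ⊥ ∧ (∀ g : G, ∃ n ∈ N, ∃ h ∈ H, g = n * h)

theorem IsFrobeniusSplit.of_mulEquiv {G G' : Type*} [Group G] [Group G'] (e : G ≃* G')
    (h : IsFrobeniusSplit G) : IsFrobeniusSplit G' := by
  obtain ⟨N, H, hN, ⟨f⟩, ⟨hcard, hcomm⟩, hinf, hmul⟩ := h
  refine ⟨N.map e.toMonoidHom, H.map e.toMonoidHom, hN.map _ e.surjective,
    ⟨(e.subgroupMap N).symm.trans f⟩, ⟨?_, fun hc => hcomm fun a b => ?_⟩, ?_, fun g => ?_⟩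
  · rw [← hcard]
    exact Nat.card_congr (e.subgroupMap H).symm.toEquiv
  · apply (e.subgroupMap H).injective
    rw [map_mul, map_mul]
    exact hc _ _
  · rw [← Subgroup.map_inf _ _ _ e.injective, hinf, Subgroup.map_bot]
  · obtain ⟨n, hn, h, hh, heq⟩ := hmul (e.symm g)
    exact ⟨e n, ⟨n, hn, rfl⟩, e h, ⟨h, hh, rfl⟩, by rw [← map_mul, ← heq, e.apply_symm_apply]⟩

/-- The points of the model design: an affine 3-space over `𝔽₂` (the center block) and the
points of a cyclic Fano plane. -/
abbrev ModelPoint := (ZMod 2 × ZMod 2 × ZMod 2) ⊕ Fin 7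

namespace ModelPoint

/-- The linear functionals on `𝔽₂³` cutting out the planes of the model design. -/
def functional (i : Fin 7) (v : ZMod 2 × ZMod 2 × ZMod 2) : ZMod 2 :=
  let w : ZMod 2 × ZMod 2 × ZMod 2 :=
    ![(0, 0, 1), (1, 0, 0), (1, 1, 0), (1, 1, 1), (0, 1, 1), (1, 0, 1), (0, 1, 0)] i
  w.1 * v.1 + w.2.1 * v.2.1 + w.2.2 * v.2.2

/-- Incidence of a point with the `i`-th base block of the model design. -/
def inc : ModelPoint → Fin 7 → Bool
  | Sum.inl v, i => functional i v = 0
  | Sum.inr y, i => i - y ≠ 0 ∧ i - y ≠ 1 ∧ i - y ≠ 3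

/-- A permutation preserves the center block and permutes the pairs consisting of a base block and
its symmetric difference with the center block. -/
def IsAut (σ : Equiv.Perm ModelPoint) : Prop :=
  (∀ x, (σ x).isLeft = x.isLeft) ∧
    ∀ i, ∃ j c, ∀ x, inc (σ x) j = xor (inc x i) (c && x.isLeft)

theorem ext_inc : ∀ x y : ModelPoint, x.isLeft = y.isLeft → (∀ i, inc x i = inc y i) → x = y := by
  decide

theorem index_ext : ∀ i j, (∀ y, inc (Sum.inr y) i = inc (Sum.inr y) j) → i = j := by decide

theorem inc_zero : ∀ i, inc (Sum.inl 0) i = true := by decide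

theorem exists_point_inc : ∀ i j, i ≠ j → ∃ v, v ≠ 0 ∧
    ∀ k, inc (Sum.inl v) k = true ↔ k = i ∨ k = j ∨ k = cyclicThird i j := by decide

theorem exists_point_inc' : ∀ i j, i ≠ j → ∃ y,
    ∀ k, inc (Sum.inr y) k = false ↔ k = i ∨ k = j ∨ k = cyclicThird' i j := by decide

theorem eq_cyclicThird : ∀ i j, i ≠ j → ∀ v, v ≠ 0 → inc (Sum.inl v) i = true →
    inc (Sum.inl v) j = true →
    ∀ k, inc (Sum.inl v) k = true → k ≠ i → k ≠ j → k = cyclicThird i j := by decide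

theorem eq_cyclicThird' : ∀ i j, i ≠ j → ∀ y, inc (Sum.inr y) i = false →
    inc (Sum.inr y) j = false →
    ∀ k, inc (Sum.inr y) k = false → k ≠ i → k ≠ j → k = cyclicThird' i j := by decide

/-- Translations of the affine space. -/
def translation : Multiplicative (ZMod 2 × ZMod 2 × ZMod 2) →* Equiv.Perm ModelPoint where
  toFun v := Equiv.sumCongr (Equiv.addLeft v.toAdd) (Equiv.refl _)
  map_one' := by ext x; rcases x with x | x <;> simp
  map_mul' a b := by ext x; rcases x with x | x <;> simp [add_assoc]

@[simp] theorem translation_inl (v : Multiplicative (ZMod 2 × ZMod 2 × ZMod 2)) (w) :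
    translation v (Sum.inl w) = Sum.inl (v.toAdd + w) := rfl

@[simp] theorem translation_inr (v : Multiplicative (ZMod 2 × ZMod 2 × ZMod 2)) (y) :
    translation v (Sum.inr y) = Sum.inr y := rfl

theorem isAut_translation (v : Multiplicative (ZMod 2 × ZMod 2 × ZMod 2)) :
    IsAut (translation v) := by
  refine ⟨by rintro (x | x) <;> rfl, fun i => ⟨i, !inc (Sum.inl v.toAdd) i, ?_⟩⟩
  rintro (x | x)
  · have : ∀ (v x : ZMod 2 × ZMod 2 × ZMod 2) (i : Fin 7), inc (Sum.inl (v + x)) i =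
        xor (inc (Sum.inl x) i) (!inc (Sum.inl v) i) := by decide
    simpa using this v.toAdd x i
  · simp

/-- Multiplication by a generator of `𝔽₈ˣ`, acting on both parts of the model. -/
def rotation : Equiv.Perm ModelPoint :=
  Equiv.sumCongr
    ⟨fun v => (v.2.2, v.1 + v.2.2, v.2.1), fun v => (v.1 + v.2.1, v.2.2, v.1),
      by decide, by decide⟩
    (Equiv.addRight 1)

/-- The Frobenius automorphism of `𝔽₈`, acting on both parts of the model. -/
def frobenius : Equiv.Perm ModelPoint :=
  Equiv.sumCongr
    ⟨fun v => (v.1, v.2.2, v.2.1 + v.2.2), fun v => (v.1, v.2.1 + v.2.2, v.2.1),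
      by decide, by decide⟩
    ⟨fun y => 2 * y - 2, fun y => 4 * y + 1, by decide, by decide⟩

theorem inc_rotation : ∀ x i, inc (rotation x) (i + 1) = inc x i := by decide

theorem inc_frobenius : ∀ x i, inc (frobenius x) (2 * i - 1) = inc x i := by decide

/-- A permutation of the points preserving the center block and mapping the `i`-th base block to
the `ρ i`-th one. -/
def Carries (σ : Equiv.Perm ModelPoint) (ρ : Fin 7 → Fin 7) : Prop :=
  (∀ x, (σ x).isLeft = x.isLeft) ∧ ∀ x i, inc (σ x) (ρ i) = inc x i

theorem Carries.isAut {σ : Equiv.Perm ModelPoint} {ρ : Fin 7 → Fin 7} (h : Carries σ ρ) :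
    IsAut σ :=
  ⟨h.1, fun i => ⟨ρ i, false, fun x => by simp [h.2]⟩⟩

theorem Carries.mul {σ τ : Equiv.Perm ModelPoint} {ρ π : Fin 7 → Fin 7} (hσ : Carries σ ρ)
    (hτ : Carries τ π) : Carries (σ * τ) (ρ ∘ π) :=
  ⟨fun x => by simp [hσ.1, hτ.1], fun x i => by simp [hσ.2, hτ.2]⟩

theorem Carries.pow {σ : Equiv.Perm ModelPoint} {ρ : Fin 7 → Fin 7} (hσ : Carries σ ρ) (n : ℕ) :
    Carries (σ ^ n) (ρ^[n]) := by
  induction n with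
  | zero => exact ⟨fun _ => rfl, fun _ _ => rfl⟩
  | succ n ih => rw [pow_succ, Function.iterate_succ]; exact ih.mul hσ

theorem Carries.unique {σ : Equiv.Perm ModelPoint} {ρ π : Fin 7 → Fin 7} (hρ : Carries σ ρ)
    (hπ : Carries σ π) : ρ = π := by
  funext i
  refine index_ext _ _ fun y => ?_
  obtain ⟨x, hx⟩ := σ.surjective (Sum.inr y)
  rw [← hx, hρ.2, hπ.2]

theorem Carries.injective {σ : Equiv.Perm ModelPoint} {ρ : Fin 7 → Fin 7} (h : Carries σ ρ) :
    Function.Injective ρ := fun i j hij =>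
  index_ext i j fun y => by rw [← h.2, ← h.2 _ j, hij]

theorem Carries.perm_unique {σ τ : Equiv.Perm ModelPoint} {ρ : Fin 7 → Fin 7} (hσ : Carries σ ρ)
    (hτ : Carries τ ρ) : σ = τ := by
  ext1 x
  refine ext_inc _ _ (by rw [hσ.1, hτ.1]) fun i => ?_
  obtain ⟨j, rfl⟩ := Finite.surjective_of_injective hσ.injective i
  rw [hσ.2, hτ.2]

theorem IsAut.exists_carries {σ : Equiv.Perm ModelPoint} (h : IsAut σ)
    (h0 : σ (Sum.inl 0) = Sum.inl 0) : ∃ ρ, Carries σ ρ := by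
  choose ρ c hρ using h.2
  refine ⟨ρ, h.1, fun x i => ?_⟩
  have hc := hρ i (Sum.inl 0)
  rw [h0, inc_zero, inc_zero] at hc
  have : c i = false := by simpa using hc
  rw [hρ, this]
  simp

theorem Carries.cyclicThird {σ : Equiv.Perm ModelPoint} {ρ : Fin 7 → Fin 7} (h : Carries σ ρ)
    (h0 : σ (Sum.inl 0) = Sum.inl 0) {i j : Fin 7} (hij : i ≠ j)
    (hi : _root_.cyclicThird i j ≠ i) (hj : _root_.cyclicThird i j ≠ j) :
    ρ (_root_.cyclicThird i j) = _root_.cyclicThird (ρ i) (ρ j) := by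
  obtain ⟨v, hv, hinc⟩ := exists_point_inc i j hij
  obtain ⟨w, hw⟩ : ∃ w, σ (Sum.inl v) = Sum.inl w := Sum.isLeft_iff.mp (by rw [h.1]; rfl)
  have hinc' : ∀ k, inc (Sum.inl v) k = true → inc (Sum.inl w) (ρ k) = true := fun k hk => by
    rw [← hw, h.2, hk]
  refine eq_cyclicThird _ _ (h.injective.ne hij) w ?_ (hinc' _ ((hinc _).mpr (by simp)))
    (hinc' _ ((hinc _).mpr (by simp))) _ (hinc' _ ((hinc _).mpr (by simp)))
    (h.injective.ne hi) (h.injective.ne hj)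
  rintro rfl
  exact hv (Sum.inl_injective (σ.injective (hw.trans h0.symm)))

theorem Carries.cyclicThird' {σ : Equiv.Perm ModelPoint} {ρ : Fin 7 → Fin 7} (h : Carries σ ρ)
    {i j : Fin 7} (hij : i ≠ j)
    (hi : _root_.cyclicThird' i j ≠ i) (hj : _root_.cyclicThird' i j ≠ j) :
    ρ (_root_.cyclicThird' i j) = _root_.cyclicThird' (ρ i) (ρ j) := by
  obtain ⟨v, hinc⟩ := exists_point_inc' i j hij
  obtain ⟨w, hw⟩ : ∃ w, σ (Sum.inr v) = Sum.inr w := by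
    rw [← Sum.isRight_iff, ← Sum.not_isLeft, h.1]; simp
  have hinc' : ∀ k, inc (Sum.inr v) k = false → inc (Sum.inr w) (ρ k) = false := fun k hk => by
    rw [← hw, h.2, hk]
  exact eq_cyclicThird' _ _ (h.injective.ne hij) w (hinc' _ ((hinc _).mpr (by simp)))
    (hinc' _ ((hinc _).mpr (by simp))) _ (hinc' _ ((hinc _).mpr (by simp)))
    (h.injective.ne hi) (h.injective.ne hj)

/-- The action of `rotation ^ b * frobenius ^ k` on the indices of the base blocks. -/
def affineIndex (p : Fin 7 × Fin 3) (i : Fin 7) : Fin 7 := (· + 1)^[p.1] ((2 * · - 1)^[p.2] i)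

theorem carries_affine (p : Fin 7 × Fin 3) :
    Carries (rotation ^ (p.1 : ℕ) * frobenius ^ (p.2 : ℕ)) (affineIndex p) :=
  (Carries.pow ⟨by rintro (x | x) <;> rfl, inc_rotation⟩ _).mul
    (Carries.pow ⟨by rintro (x | x) <;> rfl, inc_frobenius⟩ _)

theorem affineIndex_injective : ∀ p q, affineIndex p 0 = affineIndex q 0 →
    affineIndex p 1 = affineIndex q 1 → p = q := by decide

theorem exists_affineIndex : ∀ a b, a ≠ b →
    _root_.cyclicThird' a (_root_.cyclicThird a b) =
      _root_.cyclicThird b (_root_.cyclicThird' a b) →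
    ∃ p, affineIndex p = ![a, b, _root_.cyclicThird a (_root_.cyclicThird' a b),
      _root_.cyclicThird' a b, _root_.cyclicThird b (_root_.cyclicThird' a b),
      _root_.cyclicThird a b,
      _root_.cyclicThird (_root_.cyclicThird a b) (_root_.cyclicThird' a b)] := by decide

/-- An index map of an automorphism fixing the origin is affine. -/
theorem Carries.exists_affineIndex {σ : Equiv.Perm ModelPoint} {ρ : Fin 7 → Fin 7}
    (h : Carries σ ρ) (h0 : σ (Sum.inl 0) = Sum.inl 0) : ∃ p, affineIndex p = ρ := by
  have h5 : ρ 5 = _root_.cyclicThird (ρ 0) (ρ 1) :=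
    h.cyclicThird h0 (i := 0) (j := 1) (by decide) (by decide) (by decide)
  have h3 : ρ 3 = _root_.cyclicThird' (ρ 0) (ρ 1) :=
    h.cyclicThird' (i := 0) (j := 1) (by decide) (by decide) (by decide)
  have h2 : ρ 2 = _root_.cyclicThird (ρ 0) (ρ 3) :=
    h.cyclicThird h0 (i := 0) (j := 3) (by decide) (by decide) (by decide)
  have h4 : ρ 4 = _root_.cyclicThird (ρ 1) (ρ 3) :=
    h.cyclicThird h0 (i := 1) (j := 3) (by decide) (by decide) (by decide)
  have h6 : ρ 6 = _root_.cyclicThird (ρ 5) (ρ 3) :=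
    h.cyclicThird h0 (i := 5) (j := 3) (by decide) (by decide) (by decide)
  have h4' : ρ 4 = _root_.cyclicThird' (ρ 0) (ρ 5) :=
    h.cyclicThird' (i := 0) (j := 5) (by decide) (by decide) (by decide)
  obtain ⟨p, hp⟩ := ModelPoint.exists_affineIndex (ρ 0) (ρ 1) (h.injective.ne (by decide))
    (by rw [← h5, ← h3, ← h4, ← h4'])
  refine ⟨p, hp.trans ?_⟩
  rw [← h5, ← h3, ← h2, ← h4, ← h6]
  funext i
  fin_cases i <;> rfl

theorem IsAut.eq_one {σ : Equiv.Perm ModelPoint} (h : IsAut σ)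
    (hfix : ∀ y, σ (Sum.inr y) = Sum.inr y) (h0 : σ (Sum.inl 0) = Sum.inl 0) : σ = 1 := by
  obtain ⟨ρ, hρ⟩ := h.exists_carries h0
  have : ρ = id := by
    funext i
    exact index_ext _ _ fun y => by rw [← hfix, hρ.2, hfix]; rfl
  subst this
  exact hρ.perm_unique ⟨fun _ => rfl, fun _ _ => rfl⟩

/-- The automorphism group of the model design splits. -/
theorem isFrobeniusSplit (G : Subgroup (Equiv.Perm ModelPoint)) (hG : ∀ σ, σ ∈ G ↔ IsAut σ) :
    IsFrobeniusSplit G := by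
  let τ : Multiplicative (ZMod 2 × ZMod 2 × ZMod 2) →* G :=
    translation.codRestrict G fun v => (hG _).mpr (isAut_translation v)
  let H : Subgroup G := (MulAction.stabilizer (Equiv.Perm ModelPoint)
    (Sum.inl 0 : ModelPoint)).subgroupOf G
  have hH : ∀ g : G, g ∈ H ↔ (g : Equiv.Perm ModelPoint) (Sum.inl 0) = Sum.inl 0 := fun g => by
    simp [H, Subgroup.mem_subgroupOf, MulAction.mem_stabilizer_iff]
  have hfactor : ∀ g : G, ∃ v, (τ v)⁻¹ * g ∈ H := by
    intro g
    obtain ⟨w, hw⟩ : ∃ w, (g : Equiv.Perm ModelPoint) (Sum.inl 0) = Sum.inl w :=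
      Sum.isLeft_iff.mp (by rw [((hG _).mp g.2).1]; rfl)
    refine ⟨Multiplicative.ofAdd w, ?_⟩
    rw [hH]
    change (translation (Multiplicative.ofAdd w))⁻¹ ((g : Equiv.Perm ModelPoint) _) = _
    rw [hw, Equiv.Perm.inv_eq_iff_eq]
    simp
  have hN : ∀ g : G, g ∈ τ.range ↔ ∀ y, (g : Equiv.Perm ModelPoint) (Sum.inr y) = Sum.inr y := by
    intro g
    constructor
    · rintro ⟨v, rfl⟩ y
      rfl
    · intro hg
      obtain ⟨v, hv⟩ := hfactor g
      refine ⟨v, (inv_mul_eq_one.mp (Subtype.ext ?_))⟩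
      refine IsAut.eq_one ((hG _).mp ((τ v)⁻¹ * g).2) (fun y => ?_) ((hH _).mp hv)
      change (translation v)⁻¹ ((g : Equiv.Perm ModelPoint) _) = _
      rw [hg, Equiv.Perm.inv_eq_iff_eq]
      simp
  have hτ : Function.Injective τ := by
    intro v w hvw
    have h1 : (translation v) (Sum.inl 0) = translation w (Sum.inl 0) :=
      congrArg (fun g : G => (g : Equiv.Perm ModelPoint) (Sum.inl 0)) hvw
    simpa using h1
  have haff0 : ∀ k : ℕ, (frobenius ^ k) (Sum.inl 0) = Sum.inl 0 ∧
      (rotation ^ k) (Sum.inl 0) = Sum.inl 0 := by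
    intro k
    induction k with
    | zero => simp
    | succ k ih => rw [pow_succ, pow_succ]; exact ih
  let η : Fin 7 × Fin 3 → H := fun p =>
    ⟨⟨rotation ^ (p.1 : ℕ) * frobenius ^ (p.2 : ℕ), (hG _).mpr (carries_affine p).isAut⟩, by
      rw [hH]; simp [(haff0 _).1, (haff0 _).2]⟩
  have hηval : ∀ p, ((η p : G) : Equiv.Perm ModelPoint) =
    rotation ^ (p.1 : ℕ) * frobenius ^ (p.2 : ℕ) := fun _ => rfl
  have hη : Function.Bijective η := by
    constructor
    · intro p q hpq
      have hp := carries_affine p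
      rw [← hηval, hpq, hηval] at hp
      have := hp.unique (carries_affine q)
      exact affineIndex_injective p q (congrFun this 0) (congrFun this 1)
    · rintro ⟨g, hg⟩
      rw [hH] at hg
      obtain ⟨ρ, hρ⟩ := ((hG _).mp g.2).exists_carries hg
      obtain ⟨p, rfl⟩ := hρ.exists_affineIndex hg
      exact ⟨p, Subtype.ext (Subtype.ext ((carries_affine p).perm_unique hρ))⟩
  refine ⟨τ.range, H, ⟨fun n hn g => ?_⟩, ⟨(MonoidHom.ofInjective hτ).symm⟩, ⟨?_, fun hc => ?_⟩,
    ?_, fun g => ?_⟩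
  · rw [hN] at hn ⊢
    intro y
    obtain ⟨z, hz⟩ : ∃ z, ((g⁻¹ : G) : Equiv.Perm ModelPoint) (Sum.inr y) = Sum.inr z := by
      rw [← Sum.isRight_iff, ← Sum.not_isLeft, ((hG _).mp (g⁻¹).2).1]; simp
    change (g : Equiv.Perm ModelPoint) ((n : Equiv.Perm ModelPoint)
      (((g⁻¹ : G) : Equiv.Perm ModelPoint) (Sum.inr y))) = _
    rw [hz, hn, ← hz]
    simp
  · rw [← Nat.card_eq_of_bijective η hη]
    simp
  · have h1 := congrArg (fun g : H => ((g : G) : Equiv.Perm ModelPoint) (Sum.inr 0))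
      (hc (η (1, 0)) (η (0, 1)))
    revert h1
    change (rotation ^ 1 * frobenius ^ 0) ((rotation ^ 0 * frobenius ^ 1) (Sum.inr 0)) ≠
      (rotation ^ 0 * frobenius ^ 1) ((rotation ^ 1 * frobenius ^ 0) (Sum.inr 0))
    simp only [pow_zero, pow_one, one_mul, mul_one]
    decide
  · rw [eq_bot_iff]
    rintro g ⟨hgN, hgH⟩
    rw [Subgroup.mem_bot]
    exact Subtype.ext (IsAut.eq_one ((hG _).mp g.2) ((hN _).mp hgN) ((hH _).mp hgH))
  · obtain ⟨v, hv⟩ := hfactor g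
    exact ⟨τ v, ⟨v, rfl⟩, _, hv, by group⟩

end ModelPoint

namespace IsDesign

variable {B : Finset (Finset (Fin 15))} {O : Finset (Fin 15)}

/-- A choice of seven blocks through a point `p` of a center block `O`, which together with their
symmetric differences with `O` and with `O` itself exhaust the design. -/
structure IsBase (B : Finset (Finset (Fin 15))) (O : Finset (Fin 15)) (p : Fin 15)
    (A : Fin 7 → Finset (Fin 15)) : Prop where
  injective : Function.Injective A
  mem : ∀ i, A i ∈ B
  ne_center : ∀ i, A i ≠ O
  mem_center : p ∈ O
  point_mem : ∀ i, p ∈ A i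
  eq_or : ∀ b ∈ B, b = O ∨ ∃ i, b = A i ∨ b = symmDiff O (A i)

theorem exists_isBase (hD : IsDesign B) (hO : IsCenter B O) {p : Fin 15} (hp : p ∈ O) :
    ∃ A, IsBase B O p A := by
  have hne : ∀ b ∈ B, symmDiff O b ≠ O := by
    intro b hb h
    have hb0 : b = ∅ := symmDiff_eq_left.mp h
    have := hD.2.1 b hb
    simp [hb0] at this
  have hcard : ((B.erase O).filter (p ∈ ·)).card = ((B.erase O).filter (p ∉ ·)).card := by
    refine Finset.card_nbij' (symmDiff O) (symmDiff O) ?_ ?_ ?_ ?_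
    · intro b hb
      simp only [Finset.coe_filter, Finset.mem_erase, Set.mem_ofPred_eq] at hb ⊢
      refine ⟨⟨hne b hb.1.2, hO.2 b hb.1.2 hb.1.1⟩, ?_⟩
      simp [Finset.mem_symmDiff, hp, hb.2]
    · intro b hb
      simp only [Finset.coe_filter, Finset.mem_erase, Set.mem_ofPred_eq] at hb ⊢
      refine ⟨⟨hne b hb.1.2, hO.2 b hb.1.2 hb.1.1⟩, ?_⟩
      simp [Finset.mem_symmDiff, hp, hb.2]
    · intro b _
      exact symmDiff_symmDiff_cancel_left O b
    · intro b _
      exact symmDiff_symmDiff_cancel_left O b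
  have hsum := Finset.card_filter_add_card_filter_not (s := B.erase O) (p ∈ ·)
  rw [Finset.card_erase_of_mem hO.1, hD.1] at hsum
  have h7 : ((B.erase O).filter (p ∈ ·)).card = 7 := by omega
  let E := Finset.equivFinOfCardEq h7
  have hE : ∀ i, ((E.symm i : Finset (Fin 15)) ≠ O ∧ (E.symm i : Finset (Fin 15)) ∈ B) ∧
      p ∈ (E.symm i : Finset (Fin 15)) := by
    intro i
    simpa only [Finset.mem_filter, Finset.mem_erase] using (E.symm i).2
  have hsurj : ∀ b ∈ B, b ≠ O → p ∈ b → ∃ i, b = (E.symm i : Finset (Fin 15)) := by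
    intro b hb hbO hpb
    exact ⟨E ⟨b, by simp [hb, hbO, hpb]⟩, by simp⟩
  refine ⟨fun i => (E.symm i : Finset (Fin 15)), Subtype.val_injective.comp E.symm.injective,
    fun i => (hE i).1.2, fun i => (hE i).1.1, hp, fun i => (hE i).2, fun b hb => ?_⟩
  by_cases hbO : b = O
  · exact Or.inl hbO
  · right
    by_cases hpb : p ∈ b
    · obtain ⟨i, hi⟩ := hsurj b hb hbO hpb
      exact ⟨i, Or.inl hi⟩
    · obtain ⟨i, hi⟩ := hsurj (symmDiff O b) (hO.2 b hb hbO) (hne b hb)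
        (by simp [Finset.mem_symmDiff, hp, hpb])
      exact ⟨i, Or.inr (by rw [← hi, symmDiff_symmDiff_cancel_left])⟩

variable {p : Fin 15} {A : Fin 7 → Finset (Fin 15)}

theorem card_inter_center (hD : IsDesign B) (hO : IsCenter B O) (hA : IsBase B O p A)
    (i : Fin 7) : (A i ∩ O).card = 4 :=
  hD.2.2 _ (hA.mem i) _ hO.1 (hA.ne_center i)

theorem card_inter_inter_center (hD : IsDesign B) (hO : IsCenter B O) (hA : IsBase B O p A)
    {i j : Fin 7} (hij : i ≠ j) : (A i ∩ A j ∩ O).card = 2 := by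
  have h1 := hD.2.2 _ (hA.mem i) _ (hA.mem j) (hA.injective.ne hij)
  have h2 : (symmDiff O (A i) ∩ A j).card = 4 := by
    refine hD.2.2 _ (hO.2 _ (hA.mem i) (hA.ne_center i)) _ (hA.mem j) fun h => ?_
    have := hA.point_mem j
    rw [← h] at this
    simp [Finset.mem_symmDiff, hA.mem_center, hA.point_mem i] at this
  have h3 := hD.card_inter_center hO hA j
  have h4 := Finset.card_inter_add_card_sdiff (A i ∩ A j) O
  have h5 := Finset.card_inter_add_card_sdiff (A j ∩ O) (A i)
  have h6 : symmDiff O (A i) ∩ A j = ((A j ∩ O) \ A i) ∪ ((A i ∩ A j) \ O) := by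
    ext x; simp only [Finset.mem_symmDiff, Finset.mem_inter, Finset.mem_union, Finset.mem_sdiff]
    tauto
  have h7 : A j ∩ O ∩ A i = A i ∩ A j ∩ O := by
    ext x; simp only [Finset.mem_inter]; tauto
  rw [h6, Finset.card_union_of_disjoint] at h2
  · rw [h7] at h5
    omega
  · rw [Finset.disjoint_left]
    intro x
    simp only [Finset.mem_inter, Finset.mem_sdiff]
    tauto

/-- The base blocks induce a Fano plane on the center block with a point removed. -/
theorem isFanoPlane_center (hD : IsDesign B) (hO : IsCenter B O) (hA : IsBase B O p A) :
    IsFanoPlane (O.erase p) fun i => (A i ∩ O).erase p where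
  card_points := by rw [Finset.card_erase_of_mem hA.mem_center, hD.2.1 O hO.1]
  subset i := Finset.erase_subset_erase _ Finset.inter_subset_right
  card_line i := by
    rw [Finset.card_erase_of_mem (Finset.mem_inter.mpr ⟨hA.point_mem i, hA.mem_center⟩),
      hD.card_inter_center hO hA i]
  card_inter i j hij := by
    have : (A i ∩ O).erase p ∩ (A j ∩ O).erase p = (A i ∩ A j ∩ O).erase p := by
      ext x; simp only [Finset.mem_inter, Finset.mem_erase]; tauto
    rw [this, Finset.card_erase_of_mem, hD.card_inter_inter_center hO hA hij]
    simp [hA.point_mem, hA.mem_center]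

/-- The complements of the base blocks induce a Fano plane outside the center block. -/
theorem isFanoPlane_compl (hD : IsDesign B) (hO : IsCenter B O) (hA : IsBase B O p A) :
    IsFanoPlane Oᶜ fun i => (A i ∪ O)ᶜ where
  card_points := by simp [Finset.card_compl, hD.2.1 O hO.1]
  subset i := Finset.compl_subset_compl.mpr Finset.subset_union_right
  card_line i := by
    have h1 := hD.card_inter_center hO hA i
    have h2 := Finset.card_union_add_card_inter (A i) O
    rw [hD.2.1 O hO.1, hD.2.1 _ (hA.mem i)] at h2
    rw [Finset.card_compl, Fintype.card_fin]
    omega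
  card_inter i j hij := by
    have h1 := hD.card_inter_center hO hA i
    have h1' := hD.card_inter_center hO hA j
    have h2 := Finset.card_union_add_card_inter (A i) (A j)
    have h3 := Finset.card_union_add_card_inter (A i ∪ A j) O
    have h4 := hD.2.2 _ (hA.mem i) _ (hA.mem j) (hA.injective.ne hij)
    have h5 := Finset.card_union_add_card_inter (A i ∩ O) (A j ∩ O)
    have h6 := hD.card_inter_inter_center hO hA hij
    rw [← Finset.inter_inter_distrib_right, ← Finset.union_inter_distrib_right] at h5
    rw [hD.2.1 O hO.1] at h3
    rw [hD.2.1 _ (hA.mem j), hD.2.1 _ (hA.mem i)] at h2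
    have : (A i ∪ O)ᶜ ∩ (A j ∪ O)ᶜ = (A i ∪ A j ∪ O)ᶜ := by
      ext x; simp only [Finset.mem_inter, Finset.mem_compl, Finset.mem_union]; tauto
    rw [this, Finset.card_compl, Fintype.card_fin]
    omega

/-- If every line of blocks passes through `O`, the two Fano planes share no triple. -/
theorem steinerOp_ne (hD : IsDesign B) (hO : IsCenter B O) (hA : IsBase B O p A)
    (hlines : ∀ l, IsLineIn B l → O ∈ l) {f g : Fin 7 → Fin 7 → Fin 7} (hf : IsSteinerOp f)
    (hfL : ∀ i j, i ≠ j → ∀ x, x ∈ (A i ∩ O).erase p → x ∈ (A j ∩ O).erase p →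
      ∀ m, x ∈ (A m ∩ O).erase p ↔ m = i ∨ m = j ∨ m = f i j)
    (hgM : ∀ i j, i ≠ j → ∀ x, x ∈ (A i ∪ O)ᶜ → x ∈ (A j ∪ O)ᶜ →
      ∀ m, x ∈ (A m ∪ O)ᶜ ↔ m = i ∨ m = j ∨ m = g i j)
    {i j : Fin 7} (hij : i ≠ j) : f i j ≠ g i j := by
  intro hfg
  have hP := hD.isFanoPlane_center hO hA
  have hQ := hD.isFanoPlane_compl hO hA
  have hik := (hf.ne_left i j hij).symm
  have hjk := (hf.ne_right hij).symm
  obtain ⟨y, hyi, hyj⟩ := hP.exists_common hij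
  have hyk := (hfL i j hij y hyi hyj (f i j)).mpr (by simp)
  obtain ⟨z, hzi, hzj⟩ := hQ.exists_common hij
  have hzk := (hgM i j hij z hzi hzj (f i j)).mpr (by simp [hfg])
  have hsymm : symmDiff (A i) (A j) = symmDiff O (A (f i j)) := by
    ext x
    have h1 : x ∈ O.erase p → _ := hP.covered_by_concurrent hij hik hjk hyi hyj hyk
    have h2 : x ∈ Oᶜ → _ := hQ.covered_by_concurrent hij hik hjk hzi hzj hzk
    have h3 := hA.point_mem
    have h4 := hA.mem_center
    simp only [Finset.mem_erase, Finset.mem_inter, Finset.mem_compl, Finset.mem_union] at h1 h2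
    simp only [Finset.mem_symmDiff]
    by_cases hx : x = p
    · subst hx; simp [h3, h4]
    · clear hfg hik hjk hyi hyj hyk hzi hzj hzk
      by_cases hO' : x ∈ O <;> by_cases hi : x ∈ A i <;> by_cases hj : x ∈ A j <;>
        by_cases hk : x ∈ A (f i j) <;> simp_all
  have hline := hlines _ ⟨A i, hA.mem i, A j, hA.mem j, hA.injective.ne hij,
    hsymm ▸ hO.2 _ (hA.mem _) (hA.ne_center _), rfl⟩
  rcases hline with h | h | h
  · exact hA.ne_center i h.symm
  · exact hA.ne_center j h.symm
  · have := hA.mem_center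
    rw [h] at this
    simp [Finset.mem_symmDiff, hA.point_mem] at this

/-- A design of type (C4) is isomorphic to the model design. -/
theorem exists_model (hD : IsDesign B) (hO : IsCenter B O)
    (hlines : ∀ l, IsLineIn B l → O ∈ l) :
    ∃ (p : Fin 15) (A : Fin 7 → Finset (Fin 15)) (e : Fin 15 ≃ ModelPoint), IsBase B O p A ∧
      (∀ x, (e x).isLeft = true ↔ x ∈ O) ∧ ∀ x i, ModelPoint.inc (e x) i = true ↔ x ∈ A i := by
  obtain ⟨p, hp⟩ : O.Nonempty := Finset.card_pos.mp (by rw [hD.2.1 O hO.1]; norm_num)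
  obtain ⟨A, hA⟩ := hD.exists_isBase hO hp
  have hP := hD.isFanoPlane_center hO hA
  have hQ := hD.isFanoPlane_compl hO hA
  obtain ⟨f, hf, hfL⟩ := hP.exists_steinerOp
  obtain ⟨g, hg, hgM⟩ := hQ.exists_steinerOp
  obtain ⟨s, hs⟩ := hf.exists_labelling hg fun i j hij =>
    hD.steinerOp_ne hO hA hlines hf hfL hgM hij
  have hpoint : ∀ x, ∃ v : ModelPoint, (v.isLeft = true ↔ x ∈ O) ∧
      (∀ i, ModelPoint.inc v i = true ↔ x ∈ A (s i)) ∧ (v = Sum.inl 0 ↔ x = p) := by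
    intro x
    by_cases hxp : x = p
    · subst hxp
      exact ⟨Sum.inl 0, by simp [hp], by simp [ModelPoint.inc_zero, hA.point_mem], by simp⟩
    by_cases hxO : x ∈ O
    · obtain ⟨i, j, hij, hi, hj⟩ := hP.exists_lines (Finset.mem_erase.mpr ⟨hxp, hxO⟩)
      obtain ⟨i, rfl⟩ := s.surjective i
      obtain ⟨j, rfl⟩ := s.surjective j
      have hij' : i ≠ j := fun h => hij (congrArg s h)
      obtain ⟨v, hv, hinc⟩ := ModelPoint.exists_point_inc i j hij'
      refine ⟨Sum.inl v, by simp [hxO], fun k => ?_, by simp [hv, hxp]⟩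
      have := hfL _ _ hij x hi hj (s k)
      rw [← (hs i j hij').1] at this
      simp only [s.injective.eq_iff, Finset.mem_erase, Finset.mem_inter, hxp, hxO, ne_eq,
        not_false_eq_true, true_and, and_true] at this
      rw [hinc, this]
    · obtain ⟨i, j, hij, hi, hj⟩ := hQ.exists_lines (Finset.mem_compl.mpr hxO)
      obtain ⟨i, rfl⟩ := s.surjective i
      obtain ⟨j, rfl⟩ := s.surjective j
      have hij' : i ≠ j := fun h => hij (congrArg s h)
      obtain ⟨y, hinc⟩ := ModelPoint.exists_point_inc' i j hij'
      refine ⟨Sum.inr y, by simp [hxO], fun k => ?_, by simp [hxp]⟩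
      have := hgM _ _ hij x hi hj (s k)
      rw [← (hs i j hij').2] at this
      simp only [s.injective.eq_iff, Finset.mem_compl, Finset.mem_union, hxO, or_false] at this
      rw [← not_iff_not, Bool.not_eq_true, hinc, this]
  choose e heO heA hep using hpoint
  have hinj : Function.Injective e := by
    intro x y hxy
    have hO' : x ∈ O ↔ y ∈ O := by rw [← heO, ← heO, hxy]
    have hA' : ∀ i, x ∈ A i ↔ y ∈ A i := fun i => by
      obtain ⟨i, rfl⟩ := s.surjective i
      rw [← heA, ← heA, hxy]
    have hp' : x = p ↔ y = p := by rw [← hep, ← hep, hxy]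
    by_cases hxp : x = p
    · rw [hxp, hp'.mp hxp]
    by_cases hxO : x ∈ O
    · refine hP.eq_of_mem_iff (Finset.mem_erase.mpr ⟨hxp, hxO⟩) fun i => ?_
      simp only [Finset.mem_erase, Finset.mem_inter, hA', hO', ne_eq, hp']
    · refine hQ.eq_of_mem_iff (Finset.mem_compl.mpr hxO) fun i => ?_
      simp only [Finset.mem_compl, Finset.mem_union, hA', hO']
  have hbij : Function.Bijective e :=
    (Fintype.bijective_iff_injective_and_card e).mpr ⟨hinj, by decide⟩
  refine ⟨p, A ∘ s, Equiv.ofBijective e hbij, ⟨hA.injective.comp s.injective, fun i => hA.mem _,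
    fun i => hA.ne_center _, hp, fun i => hA.point_mem _, fun b hb => ?_⟩, heO, heA⟩
  refine (hA.eq_or b hb).imp_right ?_
  rintro ⟨i, hi⟩
  exact ⟨s.symm i, by simpa using hi⟩

theorem image_center (hO : IsCenter B O) (huniq : ∀ O', IsCenter B O' → O' = O)
    {σ : Equiv.Perm (Fin 15)} (hσ : σ ∈ designAut B) : O.image σ = O := by
  refine huniq _ ⟨hσ O hO.1, fun b hb hne => ?_⟩
  have hb' : b.image ⇑σ⁻¹ ∈ B := (designAut B).inv_mem hσ b hb
  have himage : (b.image ⇑σ⁻¹).image σ = b := by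
    ext x; simp
  rw [← himage, ← Finset.image_symmDiff _ _ σ.injective]
  refine hσ _ (hO.2 _ hb' ?_)
  rintro h
  exact hne (by rw [← himage, h])

theorem mem_designAut_iff (hO : IsCenter B O) (huniq : ∀ O', IsCenter B O' → O' = O)
    (hA : IsBase B O p A) (e : Fin 15 ≃ ModelPoint) (heO : ∀ x, (e x).isLeft = true ↔ x ∈ O)
    (heA : ∀ x i, ModelPoint.inc (e x) i = true ↔ x ∈ A i) (σ : Equiv.Perm (Fin 15)) :
    σ ∈ designAut B ↔ ModelPoint.IsAut (e.permCongr σ) := by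
  have himage : ∀ s t : Finset (Fin 15), s.image σ = t ↔ ∀ x, σ x ∈ t ↔ x ∈ s := by
    intro s t
    constructor
    · rintro rfl x
      simp
    · intro h
      ext y
      obtain ⟨x, rfl⟩ := σ.surjective y
      simp [h]
  have hleft : (∀ x, (e.permCongr σ x).isLeft = x.isLeft) ↔ O.image σ = O := by
    rw [himage, ← e.forall_congr_right]
    simp [Bool.eq_iff_iff, heO]
  have hblock : ∀ i j c, (∀ x, ModelPoint.inc (e.permCongr σ x) j =
      xor (ModelPoint.inc x i) (c && x.isLeft)) ↔
        ∀ x, σ x ∈ A j ↔ (x ∈ A i ↔ ¬(c = true ∧ x ∈ O)) := by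
    intro i j c
    rw [← e.forall_congr_right]
    refine forall_congr' fun x => ?_
    rw [Equiv.permCongr_apply, Equiv.symm_apply_apply, Bool.eq_iff_iff, heA, ← heA x, ← heO x]
    cases ModelPoint.inc (e x) i <;> cases c <;> cases (e x).isLeft <;> simp
  constructor
  · intro hσ
    have hOO := image_center hO huniq hσ
    have hOO' := (himage _ _).mp hOO
    refine ⟨hleft.mpr hOO, fun i => ?_⟩
    rcases hA.eq_or _ (hσ _ (hA.mem i)) with h | ⟨j, h | h⟩
    · exact absurd (Finset.image_injective σ.injective (h.trans hOO.symm)) (hA.ne_center i)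
    · refine ⟨j, false, (hblock _ _ _).mpr fun x => ?_⟩
      rw [(himage _ _).mp h x]
      simp
    · refine ⟨j, true, (hblock _ _ _).mpr fun x => ?_⟩
      have h1 := (himage _ _).mp h x
      have h2 := hOO' x
      rw [Finset.mem_symmDiff] at h1
      tauto
  · rintro ⟨h1, h2⟩
    have hOO := hleft.mp h1
    have hOO' := (himage _ _).mp hOO
    have hmem : ∀ i, (A i).image σ ∈ B ∧ (A i).image σ ≠ O := by
      intro i
      refine ⟨?_, fun h => hA.ne_center i
        (Finset.image_injective σ.injective (h.trans hOO.symm))⟩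
      obtain ⟨j, c, h⟩ := h2 i
      rw [hblock] at h
      cases c with
      | false =>
        have : (A i).image σ = A j := (himage _ _).mpr fun x => by
          have := h x
          simpa using this
        rw [this]
        exact hA.mem j
      | true =>
        have : (A i).image σ = symmDiff O (A j) := (himage _ _).mpr fun x => by
          have h1 := h x
          have h2 := hOO' x
          rw [Finset.mem_symmDiff]
          tauto
        rw [this]
        exact hO.2 _ (hA.mem j) (hA.ne_center j)
    intro b hb
    rcases hA.eq_or b hb with rfl | ⟨i, rfl | rfl⟩
    · rw [hOO]; exact hO.1
    · exact (hmem i).1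
    · rw [Finset.image_symmDiff _ _ σ.injective, hOO]
      exact hO.2 _ (hmem i).1 (hmem i).2

end IsDesign

/-- for a design of type (C4), `Aut(𝒟)` is a semidirect product of a
normal subgroup isomorphic to `(ZMod 2)³` and a subgroup isomorphic to the Frobenius
group `C₇ ⋊ C₃` of order 21 (the unique nonabelian group of order 21). -/
theorem stmt3 (B : Finset (Finset (Fin 15))) (hD : IsDesign B)
    (hC4 : ∃ O, IsCenter B O ∧ (∀ O', IsCenter B O' → O' = O) ∧
      ∀ l, IsLineIn B l → O ∈ l) :
    ∃ N H : Subgroup ↥(designAut B),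
      N.Normal ∧
      Nonempty (↥N ≃* Multiplicative (ZMod 2 × ZMod 2 × ZMod 2)) ∧
      (Nat.card ↥H = 21 ∧ ¬ (∀ a b : ↥H, a * b = b * a)) ∧
      N ⊓ H = ⊥ ∧
      (∀ g : ↥(designAut B), ∃ n ∈ N, ∃ h ∈ H, g = n * h) := by
  obtain ⟨O, hO, huniq, hlines⟩ := hC4
  obtain ⟨p, A, e, hA, heO, heA⟩ := hD.exists_model hO hlines
  have hmem : ∀ τ, τ ∈ (designAut B).map e.permCongrHom.toMonoidHom ↔ ModelPoint.IsAut τ := by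
    intro τ
    have h := IsDesign.mem_designAut_iff hO huniq hA e heO heA (e.permCongr.symm τ)
    rw [Equiv.apply_symm_apply] at h
    rw [← h]
    constructor
    · rintro ⟨σ, hσ, rfl⟩
      have : e.permCongr.symm (e.permCongr σ) ∈ designAut B := by
        rwa [Equiv.symm_apply_apply]
      exact this
    · intro hτ
      exact ⟨_, hτ, e.permCongr.apply_symm_apply τ⟩
  exact (ModelPoint.isFrobeniusSplit _ hmem).of_mulEquiv
    (e.permCongrHom.subgroupMap (designAut B)).symm
end
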